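/- Suppose the limit L = lim_{n→∞} (M_n)^{1/n} exists. Then for every integer k ≥ 2, limsup_{n→∞} (M^{Irr}_n)^{1/n} ≤ ((k−1)^{(k−1)/k} / k) · L^{(k+2)/k}, where the exponents are real exponents. -/

import Mathlib

open Filter

/-- `x` lies strictly between `p` and `q`. -/
def StrictlyBetween (p q x : ℕ) : Prop := min p q < x ∧ x < max p q

/-- Two arcs `{p, q}` and `{r, s}` cross if exactly one of `r`, `s` lies strictly
between `p` and `q`. -/
def ArcsCross (p q r s : ℕ) : Prop :=
  Xor' (StrictlyBetween p q r) (StrictlyBetween p q s)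

/-- `a` (with one-based indexing, only the values `a 1, …, a n` being relevant)
is an open meandric permutation of order `n`: it is a permutation of `{1, …, n}`
with `a i ≡ i (mod 2)`, whose upper arcs (pairs `{a i, a (i+1)}` for odd `i < n`)
are pairwise noncrossing, whose lower arcs (pairs `{a i, a (i+1)}` for even
`1 ≤ i < n`) are pairwise noncrossing, such that no lower arc strictly encloses
`a 1`, and no lower arc (if `n` is even) resp. upper arc (if `n` is odd)
strictly encloses `a n`. -/
def IsOpenMeandricPerm (n : ℕ) (a : ℕ → ℕ) : Prop :=
  1 ≤ n ∧
  (∀ i, 1 ≤ i → i ≤ n → 1 ≤ a i ∧ a i ≤ n) ∧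
  (∀ i j, 1 ≤ i → i ≤ n → 1 ≤ j → j ≤ n → a i = a j → i = j) ∧
  (∀ i, 1 ≤ i → i ≤ n → a i % 2 = i % 2) ∧
  (∀ i j, Odd i → i < n → Odd j → j < n →
      ¬ ArcsCross (a i) (a (i + 1)) (a j) (a (j + 1))) ∧
  (∀ i j, Even i → 1 ≤ i → i < n → Even j → 1 ≤ j → j < n →
      ¬ ArcsCross (a i) (a (i + 1)) (a j) (a (j + 1))) ∧
  (∀ i, Even i → 1 ≤ i → i < n → ¬ StrictlyBetween (a i) (a (i + 1)) (a 1)) ∧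
  (if Even n
    then ∀ i, Even i → 1 ≤ i → i < n → ¬ StrictlyBetween (a i) (a (i + 1)) (a n)
    else ∀ i, Odd i → i < n → ¬ StrictlyBetween (a i) (a (i + 1)) (a n))

/-- An open meandric permutation of order `n` is irreducible if there are no
indices `1 ≤ k₁ < k₂ ≤ n` with `2 < k₂ - k₁ ≤ n - 2` such that the values
`a k₁, …, a k₂` form an interval of integers, i.e. their max minus their min
equals `k₂ - k₁`. -/
def IsIrreducibleMeander (n : ℕ) (a : ℕ → ℕ) : Prop :=
  ¬ ∃ k₁ k₂ : ℕ, ∃ h : k₁ < k₂, 1 ≤ k₁ ∧ k₂ ≤ n ∧ 2 < k₂ - k₁ ∧ k₂ - k₁ ≤ n - 2 ∧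
    (Finset.Icc k₁ k₂).sup' (Finset.nonempty_Icc.mpr h.le) a -
      (Finset.Icc k₁ k₂).inf' (Finset.nonempty_Icc.mpr h.le) a = k₂ - k₁

/-- An open meandric permutation of order `n` is prime if `a 1 ≠ 1` and no proper
initial segment `a 1, …, a j` (`2 ≤ j < n`) is a permutation of `{1, …, j}`. -/
def IsPrimeMeander (n : ℕ) (a : ℕ → ℕ) : Prop :=
  a 1 ≠ 1 ∧ ¬ ∃ j, 2 ≤ j ∧ j < n ∧ (Finset.Icc 1 j).image a = Finset.Icc 1 j

/-- `a` (with one-based indexing) is a closed meandric permutation of order `n`: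
a permutation of `{1, …, 2n}` with `a 1 = 1`, `a i ≡ i (mod 2)`, pairwise
noncrossing upper arcs `{a i, a (i+1)}` (odd `i < 2n`) and pairwise noncrossing
lower arcs, the latter being the `{a i, a (i+1)}` for even `1 ≤ i < 2n` together
with the wrap-around arc `{a (2n), a 1}`. -/
def IsClosedMeandricPerm (n : ℕ) (a : ℕ → ℕ) : Prop :=
  1 ≤ n ∧ a 1 = 1 ∧
  (∀ i, 1 ≤ i → i ≤ 2 * n → 1 ≤ a i ∧ a i ≤ 2 * n) ∧
  (∀ i j, 1 ≤ i → i ≤ 2 * n → 1 ≤ j → j ≤ 2 * n → a i = a j → i = j) ∧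
  (∀ i, 1 ≤ i → i ≤ 2 * n → a i % 2 = i % 2) ∧
  (∀ i j, Odd i → i < 2 * n → Odd j → j < 2 * n →
      ¬ ArcsCross (a i) (a (i + 1)) (a j) (a (j + 1))) ∧
  (∀ i j, Even i → 1 ≤ i → i < 2 * n → Even j → 1 ≤ j → j < 2 * n →
      ¬ ArcsCross (a i) (a (i + 1)) (a j) (a (j + 1))) ∧
  (∀ i, Even i → 1 ≤ i → i < 2 * n →
      ¬ ArcsCross (a i) (a (i + 1)) (a (2 * n)) (a 1) ∧
      ¬ ArcsCross (a (2 * n)) (a 1) (a i) (a (i + 1)))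

/-- `M n`: the number of open meandric permutations of order `n` (each counted
once via the normalization `a i = 0` outside `{1, …, n}`). -/
noncomputable def openMeanderCount (n : ℕ) : ℕ :=
  Set.ncard {a : ℕ → ℕ | IsOpenMeandricPerm n a ∧ ∀ i, i < 1 ∨ n < i → a i = 0}

/-- `M^{Irr} n`: the number of irreducible open meandric permutations of order `n`. -/
noncomputable def irrMeanderCount (n : ℕ) : ℕ :=
  Set.ncard {a : ℕ → ℕ | IsOpenMeandricPerm n a ∧ IsIrreducibleMeander n a ∧
    ∀ i, i < 1 ∨ n < i → a i = 0}

/-- `M^{(P)} n`: the number of prime open meandric permutations of order `n`. -/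
noncomputable def primeMeanderCount (n : ℕ) : ℕ :=
  Set.ncard {a : ℕ → ℕ | IsOpenMeandricPerm n a ∧ IsPrimeMeander n a ∧
    ∀ i, i < 1 ∨ n < i → a i = 0}

/-- `M̄ n`: the number of closed meandric permutations of order `n`. -/
noncomputable def closedMeanderCount (n : ℕ) : ℕ :=
  Set.ncard {a : ℕ → ℕ | IsClosedMeandricPerm n a ∧ ∀ i, i < 1 ∨ 2 * n < i → a i = 0}

/-! ### Arc patterns -/

theorem strictlyBetween_iff {p q x : ℕ} :
    StrictlyBetween p q x ↔ (p < x ∧ x < q) ∨ (q < x ∧ x < p) := by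
  unfold StrictlyBetween
  omega

/-- An open meandric permutation with the parity condition dropped. -/
structure IsArcPattern (n : ℕ) (a : ℕ → ℕ) : Prop where
  pos : 1 ≤ n
  mem : ∀ i, 1 ≤ i → i ≤ n → 1 ≤ a i ∧ a i ≤ n
  inj : ∀ i j, 1 ≤ i → i ≤ n → 1 ≤ j → j ≤ n → a i = a j → i = j
  noncross : ∀ i j, 1 ≤ i → i < n → 1 ≤ j → j < n → i % 2 = j % 2 →
    ¬ ArcsCross (a i) (a (i + 1)) (a j) (a (j + 1))
  head : ∀ i, 1 ≤ i → i < n → i % 2 = 0 → ¬ StrictlyBetween (a i) (a (i + 1)) (a 1)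
  last : ∀ i, 1 ≤ i → i < n → i % 2 = n % 2 → ¬ StrictlyBetween (a i) (a (i + 1)) (a n)

theorem isOpenMeandricPerm_iff {n : ℕ} {a : ℕ → ℕ} :
    IsOpenMeandricPerm n a ↔
      IsArcPattern n a ∧ ∀ i, 1 ≤ i → i ≤ n → a i % 2 = i % 2 := by
  constructor
  · rintro ⟨h1, h2, h3, h4, h5, h6, h7, h8⟩
    refine ⟨⟨h1, h2, h3, ?_, ?_, ?_⟩, h4⟩
    · intro i j hi hin hj hjn hij
      rcases Nat.even_or_odd i with he | ho
      · exact h6 i j he hi hin (by grind) hj hjn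
      · exact h5 i j ho hin (by grind) hjn
    · intro i hi hin hpar
      exact h7 i (Nat.even_iff.2 hpar) hi hin
    · intro i hi hin hpar
      split_ifs at h8 with hn
      · exact h8 i (by grind) hi hin
      · exact h8 i (by grind) hin
  · rintro ⟨⟨h1, h2, h3, h4, h5, h6⟩, h7⟩
    refine ⟨h1, h2, h3, h7, ?_, ?_, ?_, ?_⟩
    · intro i j hi hin hj hjn
      exact h4 i j hi.pos hin hj.pos hjn (by grind)
    · intro i j hi hi1 hin hj hj1 hjn
      exact h4 i j hi1 hin hj1 hjn (by grind)
    · intro i hi hi1 hin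
      exact h5 i hi1 hin (Nat.even_iff.1 hi)
    · split_ifs with hn
      · intro i hi hi1 hin
        exact h6 i hi1 hin (by grind)
      · intro i hi hin
        exact h6 i hi.pos hin (by grind)

/-- One-based entries of a list. -/
def entry (l : List ℕ) (j : ℕ) : ℕ := l.getD (j - 1) 0

/-- A list of one-based entries forming an arc pattern. -/
def IsArcList (l : List ℕ) : Prop := IsArcPattern l.length (entry l)

/-! ### Inflations -/

/-- The number of positions preceding site `s`. -/
def posOffset (f : ℕ → List ℕ) (s : ℕ) : ℕ := ∑ t ∈ Finset.range s, (f t).length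

/-- The number of values below those of site `s`. -/
def valOffset (K : ℕ) (π : ℕ → ℕ) (f : ℕ → List ℕ) (s : ℕ) : ℕ :=
  ∑ t ∈ Finset.range K with π t < π s, (f t).length

/-- The site containing position `i`. -/
def siteOf (K : ℕ) (f : ℕ → List ℕ) (i : ℕ) : ℕ :=
  ((Finset.range K).filter fun t => posOffset f (t + 1) < i).card

/-- The sequence obtained by substituting the list `f s` for site `s`, where the `K` sites are
ordered by value according to `π`. -/
def inflate (K : ℕ) (π : ℕ → ℕ) (f : ℕ → List ℕ) (i : ℕ) : ℕ :=
  if 1 ≤ i ∧ i ≤ posOffset f K then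
    valOffset K π f (siteOf K f i) + entry (f (siteOf K f i)) (i - posOffset f (siteOf K f i))
  else 0

theorem posOffset_succ (f : ℕ → List ℕ) (s : ℕ) :
    posOffset f (s + 1) = posOffset f s + (f s).length :=
  Finset.sum_range_succ _ _

theorem posOffset_mono (f : ℕ → List ℕ) : Monotone (posOffset f) :=
  monotone_nat_of_le_succ fun s => by rw [posOffset_succ]; omega

theorem exists_site (f : ℕ → List ℕ) (K i : ℕ) (hi : 1 ≤ i) (hiK : i ≤ posOffset f K) :
    ∃ s j, s < K ∧ 1 ≤ j ∧ j ≤ (f s).length ∧ i = posOffset f s + j := by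
  induction K with
  | zero => simp [posOffset] at hiK; omega
  | succ K ih =>
    by_cases h : i ≤ posOffset f K
    · obtain ⟨s, j, hs, hj⟩ := ih h
      exact ⟨s, j, by omega, hj⟩
    · rw [posOffset_succ] at hiK
      exact ⟨K, i - posOffset f K, by omega, by omega, by omega, by omega⟩

theorem siteOf_eq {K : ℕ} {f : ℕ → List ℕ} {s j : ℕ} (hs : s < K) (hj : 1 ≤ j)
    (hjs : j ≤ (f s).length) : siteOf K f (posOffset f s + j) = s := by
  have : (Finset.range K).filter (fun t => posOffset f (t + 1) < posOffset f s + j) =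
      Finset.range s := by
    ext t
    simp only [Finset.mem_filter, Finset.mem_range]
    constructor
    · rintro ⟨_, h⟩
      by_contra hts
      have := posOffset_mono f (show s + 1 ≤ t + 1 by omega)
      rw [posOffset_succ f s] at this
      omega
    · intro h
      have := posOffset_mono f (show t + 1 ≤ s by omega)
      exact ⟨by omega, by omega⟩
  rw [siteOf, this, Finset.card_range]

theorem le_posOffset {K : ℕ} {f : ℕ → List ℕ} {s j : ℕ} (hs : s < K)
    (hjs : j ≤ (f s).length) : posOffset f s + j ≤ posOffset f K := by
  have := posOffset_mono f (show s + 1 ≤ K by omega)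
  rw [posOffset_succ] at this
  omega

theorem inflate_apply {K : ℕ} {π : ℕ → ℕ} {f : ℕ → List ℕ} {s j : ℕ} (hs : s < K) (hj : 1 ≤ j)
    (hjs : j ≤ (f s).length) :
    inflate K π f (posOffset f s + j) = valOffset K π f s + entry (f s) j := by
  rw [inflate, if_pos ⟨by omega, le_posOffset hs hjs⟩, siteOf_eq hs hj hjs]
  simp

theorem inflate_outside {K : ℕ} {π : ℕ → ℕ} {f : ℕ → List ℕ} {i : ℕ}
    (hi : i < 1 ∨ posOffset f K < i) : inflate K π f i = 0 := by
  rw [inflate, if_neg (by omega)]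

theorem valOffset_add_le {K : ℕ} {π : ℕ → ℕ} {f : ℕ → List ℕ} {s t : ℕ} (hs : s < K)
    (hst : π s < π t) : valOffset K π f s + (f s).length ≤ valOffset K π f t := by
  unfold valOffset
  rw [add_comm, ← Finset.sum_insert (f := fun t => (f t).length) (by simp)]
  refine Finset.sum_le_sum_of_subset ?_
  intro r
  simp only [Finset.mem_insert, Finset.mem_filter, Finset.mem_range]
  rintro (rfl | ⟨h1, h2⟩)
  · exact ⟨hs, hst⟩
  · exact ⟨h1, h2.trans hst⟩

theorem valOffset_add_le_posOffset {K : ℕ} {π : ℕ → ℕ} {f : ℕ → List ℕ} {s : ℕ} (hs : s < K) :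
    valOffset K π f s + (f s).length ≤ posOffset f K := by
  unfold valOffset posOffset
  rw [add_comm, ← Finset.sum_insert (f := fun t => (f t).length) (by simp)]
  refine Finset.sum_le_sum_of_subset ?_
  intro r
  simp only [Finset.mem_insert, Finset.mem_filter, Finset.mem_range]
  rintro (rfl | ⟨h1, h2⟩)
  · exact hs
  · exact h1

theorem posOffset_parity {f g : ℕ → List ℕ} {K : ℕ}
    (h : ∀ s < K, (f s).length % 2 = (g s).length % 2) :
    ∀ s ≤ K, posOffset f s % 2 = posOffset g s % 2 := by
  intro s
  induction s with
  | zero => simp [posOffset]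
  | succ s ih =>
    intro hs
    rw [posOffset_succ, posOffset_succ]
    have := ih (by omega)
    have := h s (by omega)
    omega

theorem valOffset_parity {f g : ℕ → List ℕ} {K : ℕ} (π : ℕ → ℕ)
    (h : ∀ s < K, (f s).length % 2 = (g s).length % 2) (s : ℕ) :
    valOffset K π f s % 2 = valOffset K π g s % 2 := by
  unfold valOffset
  rw [Finset.sum_nat_mod, Finset.sum_nat_mod _ _ (fun t => (g t).length)]
  congr 1
  refine Finset.sum_congr rfl fun t ht => h t ?_
  simp only [Finset.mem_filter, Finset.mem_range] at ht
  exact ht.1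

section Sites

variable {K : ℕ} {π : ℕ → ℕ} {f : ℕ → List ℕ}

theorem inflate_mem_site (hf : ∀ s < K, IsArcList (f s)) {s j : ℕ} (hs : s < K) (hj : 1 ≤ j)
    (hjs : j ≤ (f s).length) :
    valOffset K π f s < inflate K π f (posOffset f s + j) ∧
      inflate K π f (posOffset f s + j) ≤ valOffset K π f s + (f s).length := by
  rw [inflate_apply hs hj hjs]
  have := (hf s hs).mem j hj hjs
  omega

theorem inflate_lt_inflate (hf : ∀ s < K, IsArcList (f s)) {s j t i : ℕ}
    (hs : s < K) (hj : 1 ≤ j) (hjs : j ≤ (f s).length) (ht : t < K) (hi : 1 ≤ i)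
    (hit : i ≤ (f t).length) (hst : π s < π t) :
    inflate K π f (posOffset f s + j) < inflate K π f (posOffset f t + i) := by
  have h1 := inflate_mem_site (π := π) hf hs hj hjs
  have h2 := inflate_mem_site (π := π) hf ht hi hit
  have h3 := valOffset_add_le (f := f) hs hst
  omega

theorem inflate_lt_iff (hπ : Set.InjOn π (Set.Iio K)) (hf : ∀ s < K, IsArcList (f s))
    {s j t i : ℕ} (hs : s < K) (hj : 1 ≤ j) (hjs : j ≤ (f s).length) (ht : t < K) (hi : 1 ≤ i)
    (hit : i ≤ (f t).length) (hst : s ≠ t) :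
    inflate K π f (posOffset f s + j) < inflate K π f (posOffset f t + i) ↔ π s < π t := by
  refine ⟨fun h => ?_, inflate_lt_inflate hf hs hj hjs ht hi hit⟩
  have hne : π s ≠ π t := fun h' => hst (hπ hs ht h')
  by_contra hcon
  exact (inflate_lt_inflate hf ht hi hit hs hj hjs (by omega)).asymm h

/-- The value at the first (`e = false`) or last (`e = true`) position of site `s`. -/
def siteEnd (K : ℕ) (π : ℕ → ℕ) (f : ℕ → List ℕ) (s : ℕ) (e : Bool) : ℕ :=
  inflate K π f (posOffset f s + if e then (f s).length else 1)

theorem siteEnd_lt_iff {g : ℕ → List ℕ} (hπ : Set.InjOn π (Set.Iio K))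
    (hf : ∀ s < K, IsArcList (f s)) (hg : ∀ s < K, IsArcList (g s))
    (hor : ∀ s < K, (g s).length % 2 = 0 →
      (entry (f s) 1 < entry (f s) (f s).length ↔ entry (g s) 1 < entry (g s) (g s).length))
    (hpar : ∀ s < K, (f s).length % 2 = (g s).length % 2)
    {s t : ℕ} {d e : Bool} (hs : s < K) (ht : t < K)
    (h : s ≠ t ∨ d = e ∨ (f s).length % 2 = 0) :
    siteEnd K π f s d < siteEnd K π f t e ↔ siteEnd K π g s d < siteEnd K π g t e := by
  have hfs := (hf s hs).pos
  have hft := (hf t ht).pos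
  have hgs := (hg s hs).pos
  have hgt := (hg t ht).pos
  by_cases hst : s = t
  · subst hst
    by_cases hde : d = e
    · subst hde
      simp
    · have hev : (f s).length % 2 = 0 := by tauto
      have hev' : (g s).length % 2 = 0 := by rw [← hpar s hs]; exact hev
      have h1 := hor s hs hev'
      have h2 := (hf s hs).inj 1 (f s).length
      have h3 := (hg s hs).inj 1 (g s).length
      unfold siteEnd
      rw [inflate_apply hs (by split_ifs <;> omega) (by split_ifs <;> omega),
        inflate_apply hs (by split_ifs <;> omega) (by split_ifs <;> omega),
        inflate_apply hs (by split_ifs <;> omega) (by split_ifs <;> omega),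
        inflate_apply hs (by split_ifs <;> omega) (by split_ifs <;> omega)]
      cases d <;> cases e <;> simp at hde ⊢ <;> omega
  · unfold siteEnd
    rw [inflate_lt_iff hπ hf hs (by split_ifs <;> omega) (by split_ifs <;> omega) ht
        (by split_ifs <;> omega) (by split_ifs <;> omega) hst,
      inflate_lt_iff hπ hg hs (by split_ifs <;> omega) (by split_ifs <;> omega) ht
        (by split_ifs <;> omega) (by split_ifs <;> omega) hst]

end Sites

theorem arcsCross_iff {p q r s : ℕ} : ArcsCross p q r s ↔
    (StrictlyBetween p q r ∧ ¬ StrictlyBetween p q s) ∨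
      (StrictlyBetween p q s ∧ ¬ StrictlyBetween p q r) :=
  Iff.rfl

theorem not_arcsCross_self (p q : ℕ) : ¬ ArcsCross p q p q := by
  simp only [arcsCross_iff, strictlyBetween_iff]
  omega

/-- The type of list that may be substituted for `k` without destroying the meandric property. -/
structure IsCompatible (k l : List ℕ) : Prop where
  arcs : IsArcList l
  parity : l.length % 2 = k.length % 2
  orient : k.length % 2 = 0 → (entry l 1 < entry l l.length ↔ entry k 1 < entry k k.length)
  entry_parity : ∀ j, 1 ≤ j → j ≤ l.length → (entry l j + j) % 2 = (entry k 1 + 1) % 2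

section Validity

variable {K : ℕ} {π : ℕ → ℕ} {f κ : ℕ → List ℕ}

theorem inflate_arc_cases {i : ℕ} (hi : 1 ≤ i) (hin : i < posOffset f K)
    (hf : ∀ s < K, IsArcList (f s)) :
    (∃ s j, s < K ∧ 1 ≤ j ∧ j < (f s).length ∧ i = posOffset f s + j) ∨
      ∃ s, s + 1 < K ∧ i = posOffset f (s + 1) ∧
        inflate K π f i = siteEnd K π f s true ∧
        inflate K π f (i + 1) = siteEnd K π f (s + 1) false := by
  obtain ⟨s, j, hs, hj, hjs, rfl⟩ := exists_site f K i hi hin.le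
  rcases hjs.lt_or_eq with h | h
  · exact Or.inl ⟨s, j, hs, hj, h, rfl⟩
  · have hK : s + 1 < K := by
      by_contra hcon
      have : K = s + 1 := by omega
      subst this
      rw [posOffset_succ] at hin
      omega
    refine Or.inr ⟨s, hK, by rw [posOffset_succ]; omega, ?_, ?_⟩
    · simp [siteEnd, h]
    · simp [siteEnd, posOffset_succ, h]

theorem site_pos_of_end (hf : ∀ s < K, IsArcList (f s)) {s : ℕ} (hs : s < K) (e : Bool) :
    1 ≤ (if e then (f s).length else 1) ∧ (if e then (f s).length else 1) ≤ (f s).length := by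
  have := (hf s hs).pos
  split_ifs <;> omega

/-- An arc inside site `s` does not separate a point of another site from anything, and points
inside `s` are not separated by points outside. -/
theorem outside_site (hf : ∀ s < K, IsArcList (f s)) (hπ : Set.InjOn π (Set.Iio K))
    {s t i : ℕ} (hs : s < K) (ht : t < K) (hst : t ≠ s) (hi : 1 ≤ i) (hit : i ≤ (f t).length) :
    inflate K π f (posOffset f t + i) ≤ valOffset K π f s ∨
      valOffset K π f s + (f s).length < inflate K π f (posOffset f t + i) := by
  have h := inflate_mem_site (π := π) hf ht hi hit
  have hne : π t ≠ π s := fun h' => hst (hπ ht hs h')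
  rcases lt_or_gt_of_ne hne with h1 | h1
  · have := valOffset_add_le (f := f) ht h1
    omega
  · have := valOffset_add_le (f := f) hs h1
    omega

theorem inflate_noncross (hπ : Set.InjOn π (Set.Iio K)) (hκ : ∀ s < K, IsArcList (κ s))
    (hf : ∀ s < K, IsCompatible (κ s) (f s))
    (ha : IsArcPattern (posOffset κ K) (inflate K π κ)) {i i' : ℕ} (hi : 1 ≤ i)
    (hin : i < posOffset f K) (hi' : 1 ≤ i') (hin' : i' < posOffset f K)
    (hii : i % 2 = i' % 2) :
    ¬ ArcsCross (inflate K π f i) (inflate K π f (i + 1))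
      (inflate K π f i') (inflate K π f (i' + 1)) := by
  have hfa : ∀ s < K, IsArcList (f s) := fun s hs => (hf s hs).arcs
  have hpar : ∀ s < K, (f s).length % 2 = (κ s).length % 2 := fun s hs => (hf s hs).parity
  have key : ∀ {s s' : ℕ} {d e : Bool}, s < K → s' < K →
      (s ≠ s' ∨ d = e ∨ (f s).length % 2 = 0) →
      (siteEnd K π f s d < siteEnd K π f s' e ↔ siteEnd K π κ s d < siteEnd K π κ s' e) :=
    fun {s s' d e} => siteEnd_lt_iff hπ hfa hκ (fun s hs => (hf s hs).orient) hpar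
  -- an arc inside a site against an arc between sites
  have mixed : ∀ {s j s' : ℕ}, s < K → 1 ≤ j → j < (f s).length → s' + 1 < K →
      (posOffset f s + j) % 2 = posOffset f (s' + 1) % 2 →
      (∀ e : Bool, (e = true → s = s') → (e = false → s = s' + 1) →
        ¬ StrictlyBetween (inflate K π f (posOffset f s + j))
          (inflate K π f (posOffset f s + j + 1)) (siteEnd K π f s e) ∧
        inflate K π f (posOffset f s + j) ≠ siteEnd K π f s e ∧
        inflate K π f (posOffset f s + j + 1) ≠ siteEnd K π f s e) := by
    intro s j s' hs hj hjs hs' hpar' e he1 he2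
    have hl := (hfa s hs).pos
    unfold siteEnd
    have hj1 := inflate_apply (π := π) (f := f) (s := s) (j := j + 1) hs (by omega) hjs
    rw [← add_assoc] at hj1
    rw [hj1, inflate_apply hs hj hjs.le, inflate_apply hs (site_pos_of_end hfa hs e).1
      (site_pos_of_end hfa hs e).2]
    cases e with
    | true =>
      obtain rfl := he1 rfl
      rw [posOffset_succ] at hpar'
      have h1 := (hfa s hs).last j hj hjs (by omega)
      have h2 := (hfa s hs).inj j (f s).length hj hjs.le hl le_rfl
      have h3 := (hfa s hs).inj (j + 1) (f s).length (by omega) (by omega) hl le_rfl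
      rw [strictlyBetween_iff] at h1 ⊢
      simp only [if_true]
      refine ⟨by omega, fun h => ?_, fun h => ?_⟩
      · exact absurd (h2 (by omega)) (by omega)
      · exact absurd (h3 (by omega)) (by omega)
    | false =>
      obtain rfl := he2 rfl
      have h1 := (hfa _ hs).head j hj hjs (by omega)
      have h2 := (hfa _ hs).inj j 1 hj hjs.le le_rfl hl
      have h3 := (hfa _ hs).inj (j + 1) 1 (by omega) (by omega) le_rfl hl
      rw [strictlyBetween_iff] at h1 ⊢
      simp only [Bool.false_eq_true, if_false]
      refine ⟨by omega, fun h => ?_, fun h => ?_⟩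
      · exact absurd (h2 (by omega)) (by omega)
      · exact absurd (h3 (by omega)) (by omega)
  have mixed' : ∀ {s j s' : ℕ}, s < K → 1 ≤ j → j < (f s).length → s' + 1 < K →
      (posOffset f s + j) % 2 = posOffset f (s' + 1) % 2 →
      ¬ ArcsCross (inflate K π f (posOffset f s + j)) (inflate K π f (posOffset f s + j + 1))
        (siteEnd K π f s' true) (siteEnd K π f (s' + 1) false) ∧
      ¬ ArcsCross (siteEnd K π f s' true) (siteEnd K π f (s' + 1) false)
        (inflate K π f (posOffset f s + j)) (inflate K π f (posOffset f s + j + 1)) := by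
    intro s j s' hs hj hjs hs' hpar'
    have hb := mixed hs hj hjs hs' hpar'
    have m1 := inflate_mem_site (π := π) hfa hs hj hjs.le
    have m2 := inflate_mem_site (π := π) hfa hs (show 1 ≤ j + 1 by omega) hjs
    rw [← add_assoc] at m2
    have oX : s' ≠ s → _ := fun h => outside_site (π := π) hfa hπ hs (show s' < K by omega) h
      (site_pos_of_end hfa (show s' < K by omega) true).1
      (site_pos_of_end hfa (show s' < K by omega) true).2
    have oY : s' + 1 ≠ s → _ := fun h => outside_site (π := π) hfa hπ hs hs' h
      (site_pos_of_end hfa hs' false).1 (site_pos_of_end hfa hs' false).2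
    have iX : s = s' → _ := fun h => hb true (fun _ => h) (by simp)
    have iY : s = s' + 1 → _ := fun h => hb false (by simp) (fun _ => h)
    change s' ≠ s → siteEnd K π f s' true ≤ _ ∨ _ < siteEnd K π f s' true at oX
    change s' + 1 ≠ s → siteEnd K π f (s' + 1) false ≤ _ ∨ _ < siteEnd K π f (s' + 1) false at oY
    simp only [arcsCross_iff, strictlyBetween_iff] at *
    clear key
    rcases eq_or_ne s s' with h | h
    · have := iX h
      have := oY (by omega)
      subst h
      constructor <;> omega
    · rcases eq_or_ne s (s' + 1) with h' | h'
      · have := iY h'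
        have := oX (by omega)
        subst h'
        constructor <;> omega
      · have := oX (by omega)
        have := oY (by omega)
        constructor <;> omega
  rcases inflate_arc_cases (π := π) hi hin hfa with ⟨s, j, hs, hj, hjs, rfl⟩ |
    ⟨s, hs, his, hA, hB⟩ <;>
  rcases inflate_arc_cases (π := π) hi' hin' hfa with ⟨s', j', hs', hj', hjs', rfl⟩ |
    ⟨s', hs', his', hA', hB'⟩
  · by_cases hss : s = s'
    · subst hss
      have h := (hfa s hs).noncross j j' hj hjs hj' hjs' (by omega)
      rw [add_assoc, add_assoc, inflate_apply hs hj hjs.le, inflate_apply hs hj' hjs'.le,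
        inflate_apply hs (show 1 ≤ j + 1 by omega) (show j + 1 ≤ _ from hjs),
        inflate_apply hs (show 1 ≤ j' + 1 by omega) (show j' + 1 ≤ _ from hjs')]
      simp only [arcsCross_iff, strictlyBetween_iff] at h ⊢
      omega
    · have m1 := inflate_mem_site (π := π) hfa hs hj hjs.le
      have m2 := inflate_mem_site (π := π) hfa hs (show 1 ≤ j + 1 by omega) hjs
      have o1 := outside_site (π := π) hfa hπ hs hs' (Ne.symm hss) hj' hjs'.le
      have o2 := outside_site (π := π) hfa hπ hs hs' (Ne.symm hss) (show 1 ≤ j' + 1 by omega) hjs'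
      rw [← add_assoc] at m2 o2
      simp only [arcsCross_iff, strictlyBetween_iff]
      omega
  · rw [hA', hB']
    exact (mixed' hs hj hjs hs' (by omega)).1
  · rw [hA, hB]
    exact (mixed' hs' hj' hjs' hs (by omega)).2
  · by_cases hss : s = s'
    · subst hss
      rw [hA, hA', hB, hB']
      exact not_arcsCross_self _ _
    rw [hA, hB, hA', hB']
    have o1 := posOffset_parity hpar (s + 1) (by omega)
    have o2 := posOffset_parity hpar (s' + 1) (by omega)
    have h1 := posOffset_succ κ s
    have h2 := posOffset_succ κ s'
    have l1 := le_posOffset (f := κ) hs (hκ _ hs).pos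
    have l2 := le_posOffset (f := κ) hs' (hκ _ hs').pos
    have q1 := (hκ s (by omega)).pos
    have q2 := (hκ s' (by omega)).pos
    have hnc := ha.noncross (posOffset κ (s + 1)) (posOffset κ (s' + 1)) (by omega)
      (by omega) (by omega) (by omega) (by omega)
    have e1 : inflate K π κ (posOffset κ (s + 1)) = siteEnd K π κ s true := by
      simp [siteEnd, posOffset_succ]
    have e2 : inflate K π κ (posOffset κ (s' + 1)) = siteEnd K π κ s' true := by
      simp [siteEnd, posOffset_succ]
    have e3 : inflate K π κ (posOffset κ (s + 1) + 1) = siteEnd K π κ (s + 1) false := by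
      simp [siteEnd]
    have e4 : inflate K π κ (posOffset κ (s' + 1) + 1) = siteEnd K π κ (s' + 1) false := by
      simp [siteEnd]
    rw [e1, e2, e3, e4] at hnc
    have ev : s + 1 = s' → (f s').length % 2 = 0 := by
      rintro rfl
      rw [posOffset_succ f (s + 1)] at his'
      omega
    have ev' : s' + 1 = s → (f s).length % 2 = 0 := by
      rintro rfl
      rw [posOffset_succ f (s' + 1)] at his
      omega
    have c1 : ∀ {d e : Bool}, (siteEnd K π f s d < siteEnd K π f s' e ↔ _) := fun {d e} =>
      key (d := d) (e := e) (show s < K by omega) (show s' < K by omega) (Or.inl hss)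
    have c1' : ∀ {d e : Bool}, (siteEnd K π f s' d < siteEnd K π f s e ↔ _) := fun {d e} =>
      key (d := d) (e := e) (show s' < K by omega) (show s < K by omega) (Or.inl (Ne.symm hss))
    have c2 : ∀ {d e : Bool}, (siteEnd K π f (s + 1) d < siteEnd K π f (s' + 1) e ↔ _) :=
      fun {d e} => key (d := d) (e := e) hs hs' (Or.inl (by omega))
    have c2' : ∀ {d e : Bool}, (siteEnd K π f (s' + 1) d < siteEnd K π f (s + 1) e ↔ _) :=
      fun {d e} => key (d := d) (e := e) hs' hs (Or.inl (by omega))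
    have c3 : ∀ {d e : Bool}, (siteEnd K π f (s + 1) d < siteEnd K π f s' e ↔ _) := fun {d e} =>
      key (d := d) (e := e) hs (show s' < K by omega) (by
        rcases eq_or_ne (s + 1) s' with h | h
        · exact Or.inr (Or.inr (by rw [h]; exact ev h))
        · exact Or.inl h)
    have c3' : ∀ {d e : Bool}, (siteEnd K π f s' d < siteEnd K π f (s + 1) e ↔ _) := fun {d e} =>
      key (d := d) (e := e) (show s' < K by omega) hs (by
        rcases eq_or_ne (s + 1) s' with h | h
        · exact Or.inr (Or.inr (ev h))
        · exact Or.inl h.symm)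
    have c4 : ∀ {d e : Bool}, (siteEnd K π f (s' + 1) d < siteEnd K π f s e ↔ _) := fun {d e} =>
      key (d := d) (e := e) hs' (show s < K by omega) (by
        rcases eq_or_ne (s' + 1) s with h | h
        · exact Or.inr (Or.inr (by rw [h]; exact ev' h))
        · exact Or.inl h)
    have c4' : ∀ {d e : Bool}, (siteEnd K π f s d < siteEnd K π f (s' + 1) e ↔ _) := fun {d e} =>
      key (d := d) (e := e) (show s < K by omega) hs' (by
        rcases eq_or_ne (s' + 1) s with h | h
        · exact Or.inr (Or.inr (ev' h))
        · exact Or.inl h.symm)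
    simp only [arcsCross_iff, strictlyBetween_iff] at hnc ⊢
    rw [c1, c1', c2, c2', c3, c3', c4, c4']
    exact hnc

theorem inflate_exposed (hπ : Set.InjOn π (Set.Iio K)) (hκ : ∀ s < K, IsArcList (κ s))
    (hf : ∀ s < K, IsCompatible (κ s) (f s))
    (ha : IsArcPattern (posOffset κ K) (inflate K π κ)) {i t : ℕ} {e : Bool} (ht : t < K)
    (hte : (e = false ∧ t = 0) ∨ (e = true ∧ t + 1 = K)) (hi : 1 ≤ i)
    (hin : i < posOffset f K) (hip : i % 2 = if e then posOffset f K % 2 else 0) :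
    ¬ StrictlyBetween (inflate K π f i) (inflate K π f (i + 1)) (siteEnd K π f t e) := by
  have hfa : ∀ s < K, IsArcList (f s) := fun s hs => (hf s hs).arcs
  have hpar : ∀ s < K, (f s).length % 2 = (κ s).length % 2 := fun s hs => (hf s hs).parity
  have key : ∀ {s s' : ℕ} {d e : Bool}, s < K → s' < K →
      (s ≠ s' ∨ d = e ∨ (f s).length % 2 = 0) →
      (siteEnd K π f s d < siteEnd K π f s' e ↔ siteEnd K π κ s d < siteEnd K π κ s' e) :=
    fun {s s' d e} => siteEnd_lt_iff hπ hfa hκ (fun s hs => (hf s hs).orient) hpar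
  rcases inflate_arc_cases (π := π) hi hin hfa with ⟨s, j, hs, hj, hjs, rfl⟩ |
    ⟨s, hs, his, hA, hB⟩
  · rcases eq_or_ne t s with rfl | hts
    · have hl := (hfa t ht).pos
      unfold siteEnd
      rw [add_assoc, inflate_apply hs hj hjs.le,
        inflate_apply hs (show 1 ≤ j + 1 by omega) (show j + 1 ≤ _ from hjs),
        inflate_apply hs (site_pos_of_end hfa ht e).1 (site_pos_of_end hfa ht e).2]
      rcases hte with ⟨rfl, rfl⟩ | ⟨rfl, hK⟩
      · have h1 := (hfa 0 ht).head j hj hjs (by simpa [posOffset] using hip)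
        simp only [strictlyBetween_iff, Bool.false_eq_true, if_false] at h1 ⊢
        omega
      · subst hK
        rw [posOffset_succ] at hip
        simp only [if_true] at hip
        have h1 := (hfa t ht).last j hj hjs (by omega)
        simp only [strictlyBetween_iff, if_true] at h1 ⊢
        omega
    · have m1 := inflate_mem_site (π := π) hfa hs hj hjs.le
      have m2 := inflate_mem_site (π := π) hfa hs (show 1 ≤ j + 1 by omega) hjs
      have o1 := outside_site (π := π) hfa hπ hs ht hts (site_pos_of_end hfa ht e).1
        (site_pos_of_end hfa ht e).2
      rw [← add_assoc] at m2
      change siteEnd K π f t e ≤ _ ∨ _ < siteEnd K π f t e at o1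
      simp only [strictlyBetween_iff]
      omega
  · rw [hA, hB]
    have o1 := posOffset_parity hpar (s + 1) (by omega)
    have o2 := posOffset_parity hpar K le_rfl
    have h1 := posOffset_succ κ s
    have l1 := le_posOffset (f := κ) hs (hκ _ hs).pos
    have q1 := (hκ s (by omega)).pos
    have e1 : inflate K π κ (posOffset κ (s + 1)) = siteEnd K π κ s true := by
      simp [siteEnd, posOffset_succ]
    have e3 : inflate K π κ (posOffset κ (s + 1) + 1) = siteEnd K π κ (s + 1) false := by
      simp [siteEnd]
    have hne : ¬ StrictlyBetween (siteEnd K π κ s true) (siteEnd K π κ (s + 1) false)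
        (siteEnd K π κ t e) := by
      rw [← e1, ← e3]
      rcases hte with ⟨rfl, rfl⟩ | ⟨rfl, hK⟩
      · simp only [Bool.false_eq_true, if_false] at hip
        have := ha.head (posOffset κ (s + 1)) (by omega) (by omega) (by omega)
        simpa [siteEnd, posOffset] using this
      · subst hK
        simp only [if_true] at hip
        have := ha.last (posOffset κ (s + 1)) (by omega) (by omega) (by omega)
        simpa [siteEnd, posOffset_succ] using this
    have ev : s = t → e = true ∨ (f s).length % 2 = 0 := by
      rintro rfl
      rcases hte with ⟨rfl, rfl⟩ | ⟨rfl, hK⟩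
      · simp only [Bool.false_eq_true, if_false, posOffset_succ] at hip his
        right
        simp [posOffset] at his
        omega
      · exact Or.inl rfl
    have ev' : s + 1 = t → e = false ∨ (f t).length % 2 = 0 := by
      rintro rfl
      rcases hte with ⟨rfl, h0⟩ | ⟨rfl, hK⟩
      · omega
      · subst hK
        rw [posOffset_succ f (s + 1)] at hip
        simp only [if_true] at hip
        right
        omega
    have c1 : s ≠ t ∨ true = e ∨ (f s).length % 2 = 0 := by
      rcases eq_or_ne s t with h | h
      · exact Or.inr ((ev h).imp Eq.symm id)
      · exact Or.inl h
    have c1' : t ≠ s ∨ e = true ∨ (f t).length % 2 = 0 := by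
      rcases eq_or_ne s t with h | h
      · rw [← h]; exact Or.inr (ev h)
      · exact Or.inl h.symm
    have c2' : s + 1 ≠ t ∨ false = e ∨ (f (s + 1)).length % 2 = 0 := by
      rcases eq_or_ne (s + 1) t with h | h
      · rw [h]; exact Or.inr ((ev' h).imp Eq.symm id)
      · exact Or.inl h
    have c2'' : t ≠ s + 1 ∨ e = false ∨ (f t).length % 2 = 0 := by
      rcases eq_or_ne (s + 1) t with h | h
      · exact Or.inr (ev' h)
      · exact Or.inl h.symm
    simp only [strictlyBetween_iff] at hne ⊢
    rw [key (show s < K by omega) ht c1, key ht (show s < K by omega) c1', key hs ht c2',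
      key ht hs c2'']
    exact hne

/-- Replacing sites by compatible lists preserves open meandric permutations. -/
theorem isOpenMeandricPerm_inflate (hK : 1 ≤ K) (hπ : Set.InjOn π (Set.Iio K))
    (hκ : ∀ s < K, IsArcList (κ s)) (hf : ∀ s < K, IsCompatible (κ s) (f s))
    (ha : IsOpenMeandricPerm (posOffset κ K) (inflate K π κ)) :
    IsOpenMeandricPerm (posOffset f K) (inflate K π f) := by
  rw [isOpenMeandricPerm_iff] at ha ⊢
  obtain ⟨ha, hap⟩ := ha
  have hfa : ∀ s < K, IsArcList (f s) := fun s hs => (hf s hs).arcs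
  have hpar : ∀ s < K, (f s).length % 2 = (κ s).length % 2 := fun s hs => (hf s hs).parity
  have hpos : 1 ≤ posOffset f K := by
    have := le_posOffset (f := f) (show 0 < K by omega) (hfa 0 (by omega)).pos
    omega
  refine ⟨⟨hpos, ?_, ?_, ?_, ?_, ?_⟩, ?_⟩
  · intro i hi hin
    obtain ⟨s, j, hs, hj, hjs, rfl⟩ := exists_site f K i hi hin
    have h1 := inflate_mem_site (π := π) hfa hs hj hjs
    have h2 := valOffset_add_le_posOffset (π := π) (f := f) hs
    omega
  · intro i i' hi hin hi' hin' h
    obtain ⟨s, j, hs, hj, hjs, rfl⟩ := exists_site f K i hi hin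
    obtain ⟨s', j', hs', hj', hjs', rfl⟩ := exists_site f K i' hi' hin'
    rcases eq_or_ne s s' with rfl | hss
    · rw [inflate_apply hs hj hjs, inflate_apply hs hj' hjs'] at h
      rw [(hfa s hs).inj j j' hj hjs hj' hjs' (by omega)]
    · have m1 := inflate_mem_site (π := π) hfa hs hj hjs
      have o1 := outside_site (π := π) hfa hπ hs hs' hss.symm hj' hjs'
      omega
  · intro i j hi hin hj hjn hij
    exact inflate_noncross hπ hκ hf ha hi hin hj hjn hij
  · intro i hi hin hip
    have := inflate_exposed hπ hκ hf ha (e := false) (show 0 < K by omega) (by simp) hi hin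
      (by simpa using hip)
    simpa [siteEnd, posOffset] using this
  · intro i hi hin hip
    obtain ⟨t, rfl⟩ : ∃ t, K = t + 1 := ⟨K - 1, by omega⟩
    have := inflate_exposed hπ hκ hf ha (e := true) (show t < t + 1 by omega) (by simp) hi hin
      (by simpa using hip)
    simpa [siteEnd, posOffset_succ] using this
  · intro i hi hin
    obtain ⟨s, j, hs, hj, hjs, rfl⟩ := exists_site f K i hi hin
    have q := (hκ s hs).pos
    have h1 := hap (posOffset κ s + 1) (by omega) (le_posOffset hs q)
    rw [inflate_apply hs le_rfl q] at h1
    rw [inflate_apply hs hj hjs]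
    have h2 := (hf s hs).entry_parity j hj hjs
    have h3 := posOffset_parity hpar s hs.le
    have h4 := valOffset_parity π hpar s
    omega

end Validity

/-- The positions `i, …, j` carry an interval of the values taken at positions `1, …, n`. -/
structure IsBlock (n : ℕ) (a : ℕ → ℕ) (i j : ℕ) : Prop where
  one_le : 1 ≤ i
  le : i ≤ j
  le_length : j ≤ n
  not_between : ∀ k, 1 ≤ k → k ≤ n → (k < i ∨ j < k) → ∀ p q, i ≤ p → p ≤ j → i ≤ q → q ≤ j →
    a p < a k → ¬ a k < a q

/-- No two or more consecutive sites, other than all of them, have consecutive ranks. -/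
def IsSimple (K : ℕ) (π : ℕ → ℕ) : Prop :=
  ∀ s t, s < t → t < K → ¬ (s = 0 ∧ t + 1 = K) →
    ∃ s₁ s₂ s', s ≤ s₁ ∧ s₁ ≤ t ∧ s ≤ s₂ ∧ s₂ ≤ t ∧ s' < K ∧ (s' < s ∨ t < s') ∧
      π s₁ < π s' ∧ π s' < π s₂

section Uniqueness

variable {K K' : ℕ} {π π' : ℕ → ℕ} {f f' : ℕ → List ℕ}

theorem isBlock_site (hf : ∀ s < K, IsArcList (f s)) (hπ : Set.InjOn π (Set.Iio K))
    {s : ℕ} (hs : s < K) :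
    IsBlock (posOffset f K) (inflate K π f) (posOffset f s + 1) (posOffset f (s + 1)) := by
  have hl := (hf s hs).pos
  have hlK := le_posOffset (f := f) hs le_rfl
  refine ⟨by omega, by rw [posOffset_succ]; omega, by rw [posOffset_succ]; omega, ?_⟩
  intro k hk hkn hout p q hp hp' hq hq' h1 h2
  rw [posOffset_succ] at *
  obtain ⟨t, i, ht, hi, hit, rfl⟩ := exists_site f K k hk hkn
  obtain ⟨p', rfl⟩ := Nat.exists_eq_add_of_lt hp
  obtain ⟨q', rfl⟩ := Nat.exists_eq_add_of_lt hq
  have hts : t ≠ s := by rintro rfl; omega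
  have mp := inflate_mem_site (π := π) hf hs (show 1 ≤ p' + 1 by omega) (by omega)
  have mq := inflate_mem_site (π := π) hf hs (show 1 ≤ q' + 1 by omega) (by omega)
  have o := outside_site (π := π) hf hπ hs ht hts hi hit
  simp only [← add_assoc] at mp mq
  omega

theorem not_isBlock_of_representatives (hf : ∀ s < K, IsArcList (f s)) (hsimp : IsSimple K π)
    {i j s t : ℕ} (hb : IsBlock (posOffset f K) (inflate K π f) i j) (hst : s < t) (ht : t < K)
    (hne : ¬ (s = 0 ∧ t + 1 = K))
    (hin : ∀ r, s ≤ r → r ≤ t → ∃ p, 1 ≤ p ∧ p ≤ (f r).length ∧ i ≤ posOffset f r + p ∧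
      posOffset f r + p ≤ j)
    (hout : ∀ r < K, (r < s ∨ t < r) → ∃ p, 1 ≤ p ∧ p ≤ (f r).length ∧
      (posOffset f r + p < i ∨ j < posOffset f r + p)) : False := by
  obtain ⟨s₁, s₂, s', h1, h1', h2, h2', h3, h3', hlt, hlt'⟩ := hsimp s t hst ht hne
  obtain ⟨p, hp, hpl, hip, hpj⟩ := hin s₁ h1 h1'
  obtain ⟨q, hq, hql, hiq, hqj⟩ := hin s₂ h2 h2'
  obtain ⟨r, hr, hrl, hro⟩ := hout s' h3 h3'
  have hle := le_posOffset (f := f) h3 hrl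
  exact hb.not_between (posOffset f s' + r) (by omega) hle hro _ _ hip hpj hiq hqj
    (inflate_lt_inflate hf (by omega) hp hpl h3 hr hrl hlt)
    (inflate_lt_inflate hf h3 hr hrl (by omega) hq hql hlt')

theorem exists_site_of_isBlock (hK : 3 ≤ K) (hf : ∀ s < K, IsArcList (f s))
    (hsimp : IsSimple K π) {i j : ℕ} (hb : IsBlock (posOffset f K) (inflate K π f) i j)
    (hij : 1 < i ∨ j < posOffset f K) :
    ∃ s < K, posOffset f s < i ∧ j ≤ posOffset f (s + 1) := by
  obtain ⟨h1, h2, h3, -⟩ := id hb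
  obtain ⟨s, p, hs, hp, hps, hi⟩ := exists_site f K i h1 (by omega)
  obtain ⟨t, q, ht, hq, hqt, hj⟩ := exists_site f K j (by omega) h3
  have hmono := posOffset_mono f
  rcases lt_trichotomy s t with hst | rfl | hst
  · exfalso
    have rep : ∀ r, s ≤ r → r ≤ t → ∃ p, 1 ≤ p ∧ p ≤ (f r).length ∧ i ≤ posOffset f r + p ∧
      posOffset f r + p ≤ j := by
      intro r hr hrt
      have hl := (hf r (by omega)).pos
      rcases hr.eq_or_lt with rfl | hr
      · exact ⟨p, hp, hps, hi.le, by omega⟩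
      · rcases hrt.eq_or_lt with rfl | hrt
        · exact ⟨q, hq, hqt, by omega, hj.ge⟩
        · have o1 := hmono (show s + 1 ≤ r by omega)
          have o2 := hmono (show r + 1 ≤ t by omega)
          rw [posOffset_succ] at o1 o2
          exact ⟨1, le_rfl, hl, by omega, by omega⟩
    by_cases hall : s = 0 ∧ t + 1 = K
    · obtain ⟨rfl, rfl⟩ := hall
      rcases hij with hij | hij
      · refine not_isBlock_of_representatives hf hsimp hb (show 1 < t by omega) ht (by omega)
          (fun r h h' => rep r (by omega) h') fun r hr hrr => ?_
        obtain rfl : r = 0 := by omega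
        exact ⟨1, le_rfl, (hf 0 hr).pos, Or.inl (by simpa [posOffset] using hij)⟩
      · refine not_isBlock_of_representatives hf hsimp hb (show 0 < t - 1 by omega) (by omega)
          (by omega) (fun r h h' => rep r h (by omega)) fun r hr hrr => ?_
        obtain rfl : r = t := by omega
        rw [posOffset_succ] at hij
        exact ⟨(f r).length, (hf r hr).pos, le_rfl, Or.inr hij⟩
    · refine not_isBlock_of_representatives hf hsimp hb hst ht hall rep fun r hr hrr => ?_
      have hl := (hf r hr).pos
      refine ⟨1, le_rfl, hl, ?_⟩
      rcases hrr with hrr | hrr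
      · have := hmono (show r + 1 ≤ s by omega)
        rw [posOffset_succ] at this
        omega
      · have := hmono (show t + 1 ≤ r by omega)
        rw [posOffset_succ] at this
        omega
  · exact ⟨s, hs, by omega, by rw [posOffset_succ]; omega⟩
  · have := hmono (show t + 1 ≤ s by omega)
    rw [posOffset_succ] at this
    omega

theorem posOffset_eq_of_inflate_eq (hK : 3 ≤ K) (hK' : 3 ≤ K') (hπ : Set.InjOn π (Set.Iio K))
    (hf : ∀ s < K, IsArcList (f s)) (hf' : ∀ s < K', IsArcList (f' s))
    (hsimp' : IsSimple K' π') (h : inflate K π f = inflate K' π' f')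
    (hm : posOffset f K = posOffset f' K') {s : ℕ} (hs : s < K) (hs' : s < K')
    (heq : posOffset f s = posOffset f' s) : posOffset f (s + 1) ≤ posOffset f' (s + 1) := by
  have hb := isBlock_site hf hπ hs
  have h0 := (hf 0 (by omega)).pos
  have hl := (hf s hs).pos
  have hprop : 1 < posOffset f s + 1 ∨ posOffset f (s + 1) < posOffset f K := by
    rcases Nat.eq_zero_or_pos s with rfl | hs0
    · right
      have h01 : posOffset f (0 + 1) = posOffset f 1 := rfl
      have := le_posOffset (f := f) (show 1 < K by omega) (hf 1 (by omega)).pos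
      omega
    · left
      have := posOffset_mono f (show 0 + 1 ≤ s by omega)
      rw [posOffset_succ f 0] at this
      omega
  rw [h, hm] at hb
  rw [hm] at hprop
  obtain ⟨u, hu, h1, h2⟩ := exists_site_of_isBlock hK' hf' hsimp' hb hprop
  rw [posOffset_succ] at h2
  rcases lt_trichotomy u s with hus | rfl | hus
  · have := posOffset_mono f' (show u + 1 ≤ s by omega)
    omega
  · rwa [posOffset_succ f]
  · have := posOffset_mono f' (show s + 1 ≤ u by omega)
    rw [posOffset_succ] at this
    have := (hf' s hs').pos
    omega

theorem list_ext_entry {l l' : List ℕ} (h : l.length = l'.length)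
    (he : ∀ j, 1 ≤ j → j ≤ l.length → entry l j = entry l' j) : l = l' := by
  refine List.ext_getElem h fun i h1 h2 => ?_
  have := he (i + 1) (by omega) (by omega)
  simpa [entry, h1, h2] using this

theorem valOffset_congr (hπ : ∀ s < K, ∀ t < K, (π s < π t ↔ π' s < π' t))
    (hl : ∀ s < K, (f s).length = (f' s).length) {s : ℕ} (hs : s < K) :
    valOffset K π f s = valOffset K π' f' s := by
  unfold valOffset
  refine Finset.sum_congr (Finset.filter_congr fun t ht => hπ t (Finset.mem_range.1 ht) s hs)
    fun t ht => hl t ?_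
  simp only [Finset.mem_filter, Finset.mem_range] at ht
  exact ht.1

theorem posOffset_congr (hl : ∀ s < K, f s = f' s) {s : ℕ} (hs : s ≤ K) :
    posOffset f s = posOffset f' s :=
  Finset.sum_congr rfl fun t ht => by rw [hl t (by simp at ht; omega)]

theorem inflate_congr (hπ : ∀ s < K, ∀ t < K, (π s < π t ↔ π' s < π' t))
    (hl : ∀ s < K, f s = f' s) : inflate K π f = inflate K π' f' := by
  funext i
  have hK := posOffset_congr hl le_rfl
  by_cases hi : 1 ≤ i ∧ i ≤ posOffset f K
  · obtain ⟨s, j, hs, hj, hjs, rfl⟩ := exists_site f K i hi.1 hi.2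
    rw [inflate_apply hs hj hjs, posOffset_congr hl hs.le,
      inflate_apply hs hj (by rwa [← hl s hs]), hl s hs,
      valOffset_congr hπ (fun s hs => by rw [hl s hs]) hs]
  · rw [inflate_outside (by omega), inflate_outside (by omega)]

theorem posOffset_le_of_inflate_eq (hK : 1 ≤ K) (hf : ∀ s < K, IsArcList (f s))
    (h : inflate K π f = inflate K' π' f') : posOffset f K ≤ posOffset f' K' := by
  by_contra hcon
  obtain ⟨t, rfl⟩ : ∃ t, K = t + 1 := ⟨K - 1, by omega⟩
  have h1 := inflate_mem_site (π := π) hf (show t < t + 1 by omega) (hf t (by omega)).pos le_rfl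
  rw [h, ← posOffset_succ, inflate_outside (by omega)] at h1
  omega

/-- The sites of a simple inflation, their contents and their relative order are determined by
the sequence. -/
theorem inflate_unique (hK : 3 ≤ K) (hK' : 3 ≤ K') (hπ : Set.InjOn π (Set.Iio K))
    (hπ' : Set.InjOn π' (Set.Iio K')) (hf : ∀ s < K, IsArcList (f s))
    (hf' : ∀ s < K', IsArcList (f' s)) (hsimp : IsSimple K π) (hsimp' : IsSimple K' π')
    (h : inflate K π f = inflate K' π' f') :
    K = K' ∧ (∀ s < K, f s = f' s) ∧ ∀ s < K, ∀ t < K, (π s < π t ↔ π' s < π' t) := by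
  have hm : posOffset f K = posOffset f' K' :=
    le_antisymm (posOffset_le_of_inflate_eq (by omega) hf h)
      (posOffset_le_of_inflate_eq (by omega) hf' h.symm)
  have hoff : ∀ s, s ≤ K → s ≤ K' → posOffset f s = posOffset f' s := by
    intro s
    induction s with
    | zero => simp [posOffset]
    | succ s ih =>
      intro hs hs'
      have := ih (by omega) (by omega)
      exact le_antisymm
        (posOffset_eq_of_inflate_eq hK hK' hπ hf hf' hsimp' h hm hs hs' this)
        (posOffset_eq_of_inflate_eq hK' hK hπ' hf' hf hsimp h.symm hm.symm hs' hs this.symm)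
  have hKK : K = K' := by
    rcases lt_trichotomy K K' with hlt | heq | hlt
    · have := hoff K le_rfl hlt.le
      have := le_posOffset hlt (hf' K hlt).pos
      omega
    · exact heq
    · have := hoff K' hlt.le le_rfl
      have := le_posOffset hlt (hf K' hlt).pos
      omega
  subst hKK
  have hlen : ∀ s < K, (f s).length = (f' s).length := by
    intro s hs
    have h1 := hoff (s + 1) hs hs
    rw [posOffset_succ, posOffset_succ, hoff s hs.le hs.le] at h1
    omega
  have hord : ∀ s < K, ∀ t < K, (π s < π t ↔ π' s < π' t) := by
    intro s hs t ht
    rcases eq_or_ne s t with rfl | hst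
    · simp
    · rw [← inflate_lt_iff hπ hf hs le_rfl (hf s hs).pos ht le_rfl (hf t ht).pos hst,
        ← inflate_lt_iff hπ' hf' hs le_rfl (hf' s hs).pos ht le_rfl (hf' t ht).pos hst, h,
        hoff s hs.le hs.le, hoff t ht.le ht.le]
  refine ⟨rfl, fun s hs => list_ext_entry (hlen s hs) fun j hj hjs => ?_, hord⟩
  have h1 := inflate_apply (π := π) hs hj hjs
  have h2 := inflate_apply (π := π') hs hj (by rwa [← hlen s hs])
  rw [h, hoff s hs.le hs.le, h2, valOffset_congr hord hlen hs] at h1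
  omega

end Uniqueness

/-- The lists that occur as sites of an irreducible open meandric permutation. -/
def siteKinds : Finset (List ℕ) := {[1], [1, 2, 3], [3, 2, 1], [1, 2], [2, 1]}

section Decomposition

variable {n : ℕ} {a : ℕ → ℕ}

theorem IsArcPattern.image_eq (ha : IsArcPattern n a) :
    (Finset.Icc 1 n).image a = Finset.Icc 1 n := by
  refine Finset.eq_of_subset_of_card_le ?_ ?_
  · intro v
    simp only [Finset.mem_image, Finset.mem_Icc]
    rintro ⟨i, hi, rfl⟩
    exact ha.mem i hi.1 hi.2
  · rw [Finset.card_image_of_injOn]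
    intro i hi j hj
    simp only [Finset.coe_Icc, Set.mem_Icc] at hi hj
    exact ha.inj i j hi.1 hi.2 hj.1 hj.2

theorem IsArcPattern.surj (ha : IsArcPattern n a) {v : ℕ} (hv : 1 ≤ v) (hvn : v ≤ n) :
    ∃ i, 1 ≤ i ∧ i ≤ n ∧ a i = v := by
  have : v ∈ (Finset.Icc 1 n).image a := by
    rw [ha.image_eq]
    simp [hv, hvn]
  simpa [and_assoc] using this

theorem IsBlock.lt_of_lt (ha : IsArcPattern n a) {i j i' j' : ℕ} (hb : IsBlock n a i j)
    (hb' : IsBlock n a i' j') (hd : j < i' ∨ j' < i) {p p' q q' : ℕ} (hp : i ≤ p ∧ p ≤ j)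
    (hp' : i ≤ p' ∧ p' ≤ j) (hq : i' ≤ q ∧ q ≤ j') (hq' : i' ≤ q' ∧ q' ≤ j')
    (h : a p < a q) : a p' < a q' := by
  obtain ⟨h1, h2, h3, h4⟩ := hb
  obtain ⟨h1', h2', h3', h4'⟩ := hb'
  have i1 := ha.inj p' q (by omega) (by omega) (by omega) (by omega)
  have i2 := ha.inj p' q' (by omega) (by omega) (by omega) (by omega)
  have b1 := h4 q (by omega) (by omega) (by omega) p p' hp.1 hp.2 hp'.1 hp'.2 h
  by_contra hcon
  have b2 := h4' p' (by omega) (by omega) (by omega) q' q hq'.1 hq'.2 hq.1 hq.2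
  rcases eq_or_ne (a p') (a q) with e | e
  · have := i1 e
    omega
  · rcases eq_or_ne (a p') (a q') with e' | e'
    · have := i2 e'
      omega
    · omega

theorem IsBlock.sup_sub_inf (ha : IsArcPattern n a) {i j : ℕ} (hb : IsBlock n a i j)
    (hne : (Finset.Icc i j).Nonempty) :
    (Finset.Icc i j).sup' hne a - (Finset.Icc i j).inf' hne a = j - i := by
  obtain ⟨h1, h2, h3, h4⟩ := hb
  obtain ⟨q, hq, hqe⟩ := Finset.exists_mem_eq_sup' hne a
  obtain ⟨p, hp, hpe⟩ := Finset.exists_mem_eq_inf' hne a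
  have himg : (Finset.Icc i j).image a = Finset.Icc (a p) (a q) := by
    ext v
    simp only [Finset.mem_image, Finset.mem_Icc] at *
    constructor
    · rintro ⟨k, hk, rfl⟩
      rw [← hpe, ← hqe]
      exact ⟨Finset.inf'_le a (by simpa using hk), Finset.le_sup' a (by simpa using hk)⟩
    · rintro ⟨hv1, hv2⟩
      have b1 := ha.mem p (by omega) (by omega)
      have b2 := ha.mem q (by omega) (by omega)
      obtain ⟨k, hk, hkn, rfl⟩ := ha.surj (v := v) (by omega) (by omega)
      refine ⟨k, ?_, rfl⟩
      by_contra hcon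
      have i1 := ha.inj p k (by omega) (by omega) hk hkn
      have i2 := ha.inj q k (by omega) (by omega) hk hkn
      refine h4 k hk hkn (by omega) p q hp.1 hp.2 hq.1 hq.2 ?_ ?_
      · refine lt_of_le_of_ne hv1 fun e => ?_
        have := i1 e
        omega
      · refine lt_of_le_of_ne hv2 fun e => ?_
        have := i2 e.symm
        omega
  have hc := congrArg Finset.card himg
  rw [Finset.card_image_of_injOn, Nat.card_Icc, Nat.card_Icc] at hc
  · have : a p ≤ a q := by
      rw [← hpe, ← hqe]
      exact (Finset.inf'_le a hq).trans (Finset.le_sup' a hq)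
    rw [hpe, hqe]
    omega
  · intro x hx y hy
    simp only [Finset.coe_Icc, Set.mem_Icc] at hx hy
    exact ha.inj x y (by omega) (by omega) (by omega) (by omega)

open Classical in
/-- The length of the site following position `i`. -/
noncomputable def siteStep (n : ℕ) (a : ℕ → ℕ) (i : ℕ) : ℕ :=
  if IsBlock n a (i + 1) (i + 3) then 3 else if IsBlock n a (i + 1) (i + 2) then 2 else 1

/-- The position preceding site `s`. -/
noncomputable def siteStart (n : ℕ) (a : ℕ → ℕ) : ℕ → ℕ
  | 0 => 0
  | s + 1 => siteStart n a s + siteStep n a (siteStart n a s)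

theorem siteStep_cases (n : ℕ) (a : ℕ → ℕ) (i : ℕ) :
    siteStep n a i = 1 ∨ siteStep n a i = 2 ∨ siteStep n a i = 3 := by
  unfold siteStep
  split_ifs <;> simp

theorem isBlock_siteStep {i : ℕ} (hi : i < n) : IsBlock n a (i + 1) (i + siteStep n a i) := by
  unfold siteStep
  split_ifs with h1 h2
  · exact h1
  · exact h2
  · refine ⟨by omega, le_rfl, hi, ?_⟩
    intro k _ _ _ p q hp hp' hq hq' h h'
    obtain rfl : p = i + 1 := by omega
    obtain rfl : q = i + 1 := by omega
    omega

theorem siteStep_ge {i j : ℕ} (hb : IsBlock n a (i + 1) j) (hj : j ≤ i + 3) :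
    j ≤ i + siteStep n a i := by
  unfold siteStep
  have := hb.le
  rcases (show j = i + 1 ∨ j = i + 2 ∨ j = i + 3 by omega) with rfl | rfl | rfl <;>
    split_ifs <;> omega

/-- The list of ranks of `a (i + 1), …, a (i + l)` among themselves. -/
def rankList (a : ℕ → ℕ) (i l : ℕ) : List ℕ :=
  (List.range l).map fun j =>
    ∑ r ∈ Finset.range l, if a (i + r + 1) ≤ a (i + j + 1) then 1 else 0

theorem length_rankList (a : ℕ → ℕ) (i l : ℕ) : (rankList a i l).length = l := by
  simp [rankList]

theorem entry_rankList (a : ℕ → ℕ) (i l j : ℕ) (hj : 1 ≤ j) (hjl : j ≤ l) :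
    entry (rankList a i l) j =
      ∑ r ∈ Finset.range l, if a (i + r + 1) ≤ a (i + j) then 1 else 0 := by
  obtain ⟨j, rfl⟩ : ∃ k, j = k + 1 := ⟨j - 1, by omega⟩
  have : j < l := by omega
  simp [entry, rankList, this, add_assoc]

theorem rankList_one (a : ℕ → ℕ) (i : ℕ) : rankList a i 1 = [1] := by
  change [_] = _
  simp only [Finset.sum_range_one, le_refl, if_true, Nat.add_zero]

theorem rankList_two (a : ℕ → ℕ) (i : ℕ) (h : a (i + 1) ≠ a (i + 2)) :
    rankList a i 2 = if a (i + 1) < a (i + 2) then [1, 2] else [2, 1] := by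
  change [_, _] = _
  simp only [Finset.sum_range_succ, Finset.sum_range_zero, zero_add, add_zero, add_assoc,
    Nat.reduceAdd]
  generalize a (i + 1) = x at *
  generalize a (i + 2) = y at *
  split_ifs <;> first | rfl | omega

theorem rankList_three (a : ℕ → ℕ) (i : ℕ) (h12 : a (i + 1) ≠ a (i + 2))
    (h13 : a (i + 1) ≠ a (i + 3)) (h23 : a (i + 2) ≠ a (i + 3))
    (h2 : entry (rankList a i 3) 2 % 2 ≠ entry (rankList a i 3) 1 % 2)
    (h3 : entry (rankList a i 3) 3 % 2 ≠ entry (rankList a i 3) 2 % 2) :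
    rankList a i 3 = if a (i + 1) < a (i + 2) then [1, 2, 3] else [3, 2, 1] := by
  simp only [entry_rankList, Nat.reduceLeDiff, le_refl] at h2 h3
  change [_, _, _] = _
  simp only [Finset.sum_range_succ, Finset.sum_range_zero, zero_add, add_zero, add_assoc,
    Nat.reduceAdd] at h2 h3 ⊢
  generalize a (i + 1) = x at *
  generalize a (i + 2) = y at *
  generalize a (i + 3) = z at *
  rcases lt_or_gt_of_ne h12 with h | h <;> rcases lt_or_gt_of_ne h13 with h' | h' <;>
    rcases lt_or_gt_of_ne h23 with h'' | h'' <;>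
    simp only [h, h.le, h'.le, h''.le, h.not_ge, h'.not_ge, h''.not_ge, h.not_gt, le_refl,
      if_true, if_false] at h2 h3 ⊢ <;> first | rfl | omega

theorem rankList_mem_siteKinds (ha : IsArcPattern n a) {i l : ℕ} (hl : l = 1 ∨ l = 2 ∨ l = 3)
    (hil : i + l ≤ n) {v : ℕ} (hv : ∀ j, 1 ≤ j → j ≤ l → a (i + j) = v + entry (rankList a i l) j)
    (hp : ∀ j, 1 ≤ j → j ≤ l → a (i + j) % 2 = (i + j) % 2) :
    rankList a i l ∈ siteKinds := by
  have hne : ∀ x y, 1 ≤ x → x < y → y ≤ l → a (i + x) ≠ a (i + y) := fun x y hx hxy hy h => by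
    have := ha.inj (i + x) (i + y) (by omega) (by omega) (by omega) (by omega) h
    omega
  rcases hl with rfl | rfl | rfl
  · simp [rankList_one, siteKinds]
  · rw [rankList_two a i (hne 1 2 (by omega) (by omega) (by omega))]
    split_ifs <;> simp [siteKinds]
  · have v1 := hv 1 (by omega) (by omega)
    have v2 := hv 2 (by omega) (by omega)
    have v3 := hv 3 (by omega) (by omega)
    have p1 := hp 1 (by omega) (by omega)
    have p2 := hp 2 (by omega) (by omega)
    have p3 := hp 3 (by omega) (by omega)
    rw [rankList_three a i (hne 1 2 (by omega) (by omega) (by omega))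
      (hne 1 3 (by omega) (by omega) (by omega)) (hne 2 3 (by omega) (by omega) (by omega))
      (by omega) (by omega)]
    split_ifs <;> simp [siteKinds]

theorem sum_range_posOffset (f : ℕ → List ℕ) (K : ℕ) (g : ℕ → ℕ) :
    ∑ q ∈ Finset.range (posOffset f K), g q =
      ∑ t ∈ Finset.range K, ∑ r ∈ Finset.range (f t).length, g (posOffset f t + r) := by
  induction K with
  | zero => simp [posOffset]
  | succ K ih => rw [posOffset_succ, Finset.sum_range_add, ih, Finset.sum_range_succ]

theorem IsArcPattern.eq_sum (ha : IsArcPattern n a) {p : ℕ} (hp : 1 ≤ p) (hpn : p ≤ n) :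
    a p = ∑ q ∈ Finset.range n, if a (q + 1) ≤ a p then 1 else 0 := by
  have hm := ha.mem p hp hpn
  rw [← Finset.card_filter]
  have : ((Finset.range n).filter fun q => a (q + 1) ≤ a p).image (fun q => a (q + 1)) =
      Finset.Icc 1 (a p) := by
    ext v
    simp only [Finset.mem_image, Finset.mem_filter, Finset.mem_range, Finset.mem_Icc]
    constructor
    · rintro ⟨q, ⟨hq, hq'⟩, rfl⟩
      exact ⟨(ha.mem (q + 1) (by omega) hq).1, hq'⟩
    · rintro ⟨h1, h2⟩
      obtain ⟨k, hk, hkn, rfl⟩ := ha.surj (v := v) h1 (by omega)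
      refine ⟨k - 1, ⟨by omega, ?_⟩, ?_⟩ <;> rw [Nat.sub_add_cancel hk]
      exact h2
  rw [← Finset.card_image_of_injOn (f := fun q => a (q + 1)), this, Nat.card_Icc]
  · omega
  · intro x hx y hy hxy
    simp only [Finset.coe_filter, Finset.mem_range, Set.mem_ofPred_eq] at hx hy
    have := ha.inj (x + 1) (y + 1) (by omega) hx.1 (by omega) hy.1 hxy
    omega

/-- An irreducible open meandric permutation is a simple inflation of small sites. -/
theorem exists_decomposition (hn : 7 ≤ n) (ha : IsOpenMeandricPerm n a)
    (hirr : IsIrreducibleMeander n a) (hout : ∀ i, i < 1 ∨ n < i → a i = 0) :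
    ∃ (K : ℕ) (π : ℕ → ℕ) (κ : ℕ → List ℕ), 3 ≤ K ∧ Set.InjOn π (Set.Iio K) ∧ IsSimple K π ∧
      (∀ s < K, κ s ∈ siteKinds) ∧ posOffset κ K = n ∧ inflate K π κ = a := by
  obtain ⟨ha, hpar⟩ := isOpenMeandricPerm_iff.1 ha
  set o := siteStart n a with ho
  have hsucc : ∀ s, o (s + 1) = o s + siteStep n a (o s) := fun s => rfl
  have hstep : ∀ s, o s < n → o (s + 1) ≤ n := fun s hs => (isBlock_siteStep hs).le_length
  have hlt : ∀ s, o s < o (s + 1) := fun s => by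
    rw [hsucc]
    have := siteStep_cases n a (o s)
    omega
  have hmono : StrictMono o := strictMono_nat_of_lt_succ hlt
  obtain ⟨K, hK, hKlt⟩ : ∃ K, o K = n ∧ ∀ s < K, o s < n := by
    have hex : ∃ K, n ≤ o K := ⟨n, hmono.id_le n⟩
    refine ⟨Nat.find hex, ?_, fun s hs => by simpa using Nat.find_min hex hs⟩
    refine le_antisymm ?_ (Nat.find_spec hex)
    rcases Nat.eq_zero_or_pos (Nat.find hex) with h0 | h0
    · rw [h0]
      simp [ho, siteStart]
    · have := hstep (Nat.find hex - 1) (by simpa using Nat.find_min hex (Nat.sub_lt h0 one_pos))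
      rwa [Nat.sub_add_cancel h0] at this
  have hblk : ∀ s < K, IsBlock n a (o s + 1) (o (s + 1)) := fun s hs =>
    isBlock_siteStep (hKlt s hs)
  set π : ℕ → ℕ := fun s => a (o s + 1) with hπ
  set κ : ℕ → List ℕ := fun s => rankList a (o s) (siteStep n a (o s)) with hκ
  have hlen : ∀ s, (κ s).length = siteStep n a (o s) := fun s => length_rankList _ _ _
  have hoff : ∀ s, posOffset κ s = o s := by
    intro s
    induction s with
    | zero => simp [posOffset, ho, siteStart]
    | succ s ih => rw [posOffset_succ, ih, hlen, hsucc]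
  have hinj : Set.InjOn π (Set.Iio K) := by
    intro s hs t ht hst
    have := ha.inj _ _ (by omega) (hKlt s hs) (by omega) (hKlt t ht) hst
    exact hmono.injective (by omega)
  have hsep : ∀ s t p q, s < K → t < K → s ≠ t → o s < p → p ≤ o (s + 1) → o t < q →
      q ≤ o (t + 1) → (a p < a q ↔ π s < π t) := by
    intro s t p q hs ht hst hp hp' hq hq'
    have hd : o (s + 1) < o t + 1 ∨ o (t + 1) < o s + 1 := by
      rcases lt_or_gt_of_ne hst with h | h
      · have := hmono.monotone (show s + 1 ≤ t by omega)
        omega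
      · have := hmono.monotone (show t + 1 ≤ s by omega)
        omega
    have := hlt s
    have := hlt t
    exact ⟨(hblk s hs).lt_of_lt ha (hblk t ht) hd (by omega) (by omega) (by omega) (by omega),
      (hblk s hs).lt_of_lt ha (hblk t ht) hd (by omega) (by omega) (by omega) (by omega)⟩
  have hval : ∀ s < K, ∀ j, 1 ≤ j → j ≤ (κ s).length →
      a (o s + j) = valOffset K π κ s + entry (κ s) j := by
    intro s hs j hj hjs
    have hjs' := hjs
    rw [hlen] at hjs
    have hle := le_posOffset hs hjs'
    rw [hoff, hoff, hK] at hle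
    rw [ha.eq_sum (show 1 ≤ o s + j by omega) hle]
    conv_lhs => rw [← hK, ← hoff K]
    rw [sum_range_posOffset, entry_rankList _ _ _ _ hj hjs, valOffset, Finset.sum_filter,
      ← Finset.add_sum_erase (Finset.range K) _ (Finset.mem_range.2 hs),
      ← Finset.add_sum_erase (Finset.range K) (fun t => if π t < π s then (κ t).length else 0)
        (Finset.mem_range.2 hs)]
    simp only [lt_irrefl, if_false, zero_add, hlen, hoff]
    rw [add_comm]
    congr 1
    refine Finset.sum_congr rfl fun t ht => ?_
    simp only [Finset.mem_erase, Finset.mem_range] at ht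
    have hterm : ∀ r ∈ Finset.range (siteStep n a (o t)),
        (if a (o t + r + 1) ≤ a (o s + j) then 1 else 0) = if π t < π s then 1 else 0 := by
      intro r hr
      have hr := Finset.mem_range.1 hr
      have h1 := hsep t s (o t + r + 1) (o s + j) ht.2 hs ht.1 (by omega)
        (by rw [hsucc]; omega) (by omega) (by rw [hsucc]; omega)
      have h2 := hsep s t (o s + j) (o t + r + 1) hs ht.2 ht.1.symm (by omega)
        (by rw [hsucc]; omega) (by omega) (by rw [hsucc]; omega)
      have h3 : π t ≠ π s := fun h => ht.1 (hinj ht.2 hs h)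
      refine if_congr ?_ rfl rfl
      omega
    rw [Finset.sum_congr rfl hterm]
    split_ifs <;> simp
  have hK3 : 3 ≤ K := by
    by_contra hcon
    have h1 := hmono.monotone (show K ≤ 2 by omega)
    have h2 := siteStep_cases n a (o 0)
    have h3 := siteStep_cases n a (o 1)
    have h4 : o 0 = 0 := rfl
    have h5 := hsucc 0
    have h6 := hsucc 1
    norm_num at h5 h6
    omega
  refine ⟨K, π, κ, hK3, hinj, ?_, ?_, by rw [hoff, hK], ?_⟩
  · intro s t hst ht hne
    by_contra! hcon
    have hb : IsBlock n a (o s + 1) (o (t + 1)) := by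
      have hle : o (t + 1) ≤ n := hstep t (hKlt t ht)
      have hst' := hmono (show s < t + 1 by omega)
      refine ⟨by omega, hst', hle, ?_⟩
      intro k hk hkn hko p q hp hp' hq hq' h1 h2
      have site : ∀ x, 1 ≤ x → x ≤ n → ∃ u < K, o u < x ∧ x ≤ o (u + 1) := by
        intro x hx hxn
        obtain ⟨u, j, hu, hj, hju, rfl⟩ := exists_site κ K x hx (by rwa [hoff, hK])
        rw [hlen] at hju
        exact ⟨u, hu, by rw [hoff]; omega, by rw [hoff, hsucc]; omega⟩
      have inside : ∀ x u, o s + 1 ≤ x → x ≤ o (t + 1) → o u < x → x ≤ o (u + 1) →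
          s ≤ u ∧ u ≤ t := by
        intro x u hx hx' hux hux'
        constructor
        · by_contra hc
          have := hmono.monotone (show u + 1 ≤ s by omega)
          omega
        · by_contra hc
          have := hmono.monotone (show t + 1 ≤ u by omega)
          omega
      obtain ⟨s', hs', hks, hks'⟩ := site k hk hkn
      obtain ⟨s₁, hs₁, hps, hps'⟩ := site p (by omega) (by omega)
      obtain ⟨s₂, hs₂, hqs, hqs'⟩ := site q (by omega) (by omega)
      have i1 := inside p s₁ hp hp' hps hps'
      have i2 := inside q s₂ hq hq' hqs hqs'
      have i3 : s' < s ∨ t < s' := by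
        by_contra hc
        have := hmono.monotone (show s ≤ s' by omega)
        have := hmono.monotone (show s' + 1 ≤ t + 1 by omega)
        omega
      rw [hsep s₁ s' p k hs₁ hs' (by omega) hps hps' hks hks'] at h1
      rw [hsep s' s₂ k q hs' hs₂ (by omega) hks hks' hqs hqs'] at h2
      have := hcon s₁ s₂ s' i1.1 i1.2 i2.1 i2.2 hs' i3 h1
      omega
    by_cases hshort : o (t + 1) ≤ o s + 3
    · have h1 := siteStep_ge hb hshort
      have h2 := hmono (show s + 1 < t + 1 by omega)
      rw [hsucc] at h2
      omega
    · refine hirr ⟨o s + 1, o (t + 1), by omega, by omega, hb.le_length, by omega, ?_,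
        hb.sup_sub_inf ha _⟩
      have hle := hb.le_length
      rcases Nat.eq_zero_or_pos s with rfl | hs0
      · have := hmono (show t + 1 < K by omega)
        omega
      · have := hmono hs0
        omega
  · intro s hs
    have h1 := (hblk s hs).le_length
    rw [hsucc] at h1
    refine rankList_mem_siteKinds ha (siteStep_cases _ _ _) h1
      (fun j hj hjl => hval s hs j hj (by rwa [hlen])) fun j hj hjl => ?_
    exact hpar _ (by omega) (by omega)
  · funext i
    by_cases hi : 1 ≤ i ∧ i ≤ n
    · obtain ⟨s, j, hs, hj, hjs, rfl⟩ := exists_site κ K i hi.1 (by rw [hoff, hK]; exact hi.2)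
      rw [inflate_apply hs hj hjs, ← hval s hs j hj hjs, hoff]
    · rw [inflate_outside (by rw [hoff, hK]; omega), hout i (by omega)]

end Decomposition

/-! ### Pattern families -/

instance (p q x : ℕ) : Decidable (StrictlyBetween p q x) :=
  inferInstanceAs (Decidable (min p q < x ∧ x < max p q))

instance (p q r s : ℕ) : Decidable (ArcsCross p q r s) :=
  decidable_of_iff _ arcsCross_iff.symm

/-- A computable form of `IsCompatible`. -/
def CompatibilityCheck (k l : List ℕ) : Prop :=
  1 ≤ l.length ∧
  (∀ i < l.length - 1, ∀ j < l.length - 1, i % 2 = j % 2 →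
    ¬ ArcsCross (entry l (i + 1)) (entry l (i + 2)) (entry l (j + 1)) (entry l (j + 2))) ∧
  (∀ i < l.length - 1, i % 2 = 1 →
    ¬ StrictlyBetween (entry l (i + 1)) (entry l (i + 2)) (entry l 1)) ∧
  (∀ i < l.length - 1, (i + 1) % 2 = l.length % 2 →
    ¬ StrictlyBetween (entry l (i + 1)) (entry l (i + 2)) (entry l l.length)) ∧
  l.length % 2 = k.length % 2 ∧
  (k.length % 2 = 0 → (entry l 1 < entry l l.length ↔ entry k 1 < entry k k.length)) ∧
  (∀ i < l.length, (entry l (i + 1) + (i + 1)) % 2 = (entry k 1 + 1) % 2) ∧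
  (∀ i < l.length, 1 ≤ entry l (i + 1) ∧ entry l (i + 1) ≤ l.length) ∧
  (∀ i < l.length, ∀ j < l.length, entry l (i + 1) = entry l (j + 1) → i = j)

instance (k l : List ℕ) : Decidable (CompatibilityCheck k l) := by
  unfold CompatibilityCheck
  infer_instance

theorem CompatibilityCheck.isCompatible {k l : List ℕ} (h : CompatibilityCheck k l) :
    IsCompatible k l := by
  obtain ⟨h1, h2, h3, h4, h5, h6, h7, h8, h9⟩ := h
  have e : ∀ i, 1 ≤ i → ∃ i', i = i' + 1 := fun i hi => ⟨i - 1, by omega⟩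
  refine ⟨⟨h1, ?_, ?_, ?_, ?_, ?_⟩, h5, h6, ?_⟩
  · intro i hi hin
    obtain ⟨i, rfl⟩ := e i hi
    exact h8 i (by omega)
  · intro i j hi hin hj hjn hij
    obtain ⟨i, rfl⟩ := e i hi
    obtain ⟨j, rfl⟩ := e j hj
    rw [h9 i (by omega) j (by omega) hij]
  · intro i j hi hin hj hjn hij
    obtain ⟨i, rfl⟩ := e i hi
    obtain ⟨j, rfl⟩ := e j hj
    exact h2 i (by omega) j (by omega) (by omega)
  · intro i hi hin hip
    obtain ⟨i, rfl⟩ := e i hi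
    exact h3 i (by omega) (by omega)
  · intro i hi hin hip
    obtain ⟨i, rfl⟩ := e i hi
    exact h4 i (by omega) (by omega)
  · intro i hi hin
    obtain ⟨i, rfl⟩ := e i hi
    exact h7 i (by omega)

/-- Alternate the entries of two lists. -/
def interleave : List ℕ → List ℕ → List ℕ
  | [], _ => []
  | x :: xs, [] => x :: xs
  | x :: xs, y :: ys => x :: y :: interleave xs ys

/-- All lists alternating between the entries of two given lists. -/
def interleavings (A B : List ℕ) : List (List ℕ) :=
  A.permutations'.flatMap fun p => B.permutations'.map (interleave p)

/-- Candidates for lists to be substituted for `k`. -/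
def patternCandidates (k : List ℕ) : List (List ℕ) :=
  if k.length % 2 = 1 then
    interleavings [1] [] ++ interleavings [1, 3] [2] ++ interleavings [1, 3, 5] [2, 4] ++
      interleavings [1, 3, 5, 7] [2, 4, 6]
  else if entry k 1 % 2 = 1 then
    interleavings [1] [2] ++ interleavings [1, 3] [2, 4] ++ interleavings [1, 3, 5] [2, 4, 6] ++
      interleavings [1, 3, 5, 7] [2, 4, 6, 8]
  else
    interleavings [2] [1] ++ interleavings [2, 4] [1, 3] ++ interleavings [2, 4, 6] [1, 3, 5] ++
      interleavings [2, 4, 6, 8] [1, 3, 5, 7]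

/-- The lists to be substituted for `k`. -/
def patternList (k : List ℕ) : List (List ℕ) :=
  (patternCandidates k).filter fun l => decide (CompatibilityCheck k l)

theorem isCompatible_of_mem_patternList {k l : List ℕ} (h : l ∈ patternList k) :
    IsCompatible k l := by
  simp only [patternList, List.mem_filter, decide_eq_true_eq] at h
  exact h.2.isCompatible

theorem lengths_patternList_odd : ∀ k ∈ ([[1], [1, 2, 3], [3, 2, 1]] : List (List ℕ)),
    (patternList k).map List.length = List.replicate 1 1 ++ List.replicate 2 3 ++
      List.replicate 8 5 ++ List.replicate 42 7 ∧ (patternList k).Nodup := by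
  decide +kernel

theorem lengths_patternList_even : ∀ k ∈ ([[1, 2], [2, 1]] : List (List ℕ)),
    (patternList k).map List.length = List.replicate 1 2 ++ List.replicate 3 4 ++
      List.replicate 14 6 ++ List.replicate 81 8 ∧ (patternList k).Nodup := by
  decide +kernel

/-! ### Arc systems and words -/

/-- `{p, q}` is an arc of `a` of type `e`: upper if `e = 1`, lower if `e = 0`. -/
def IsArc (n : ℕ) (a : ℕ → ℕ) (e p q : ℕ) : Prop :=
  ∃ i, 1 ≤ i ∧ i < n ∧ i % 2 = e ∧ ((a i = p ∧ a (i + 1) = q) ∨ (a i = q ∧ a (i + 1) = p))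

/-- `p` is the left end of an arc of type `e`. -/
def IsLeftEnd (n : ℕ) (a : ℕ → ℕ) (e p : ℕ) : Prop := ∃ q, p < q ∧ IsArc n a e p q

section Arcs

variable {n : ℕ} {a a' : ℕ → ℕ} {e p q : ℕ}

theorem IsArc.symm (h : IsArc n a e p q) : IsArc n a e q p := by
  obtain ⟨i, h1, h2, h3, h4⟩ := h
  exact ⟨i, h1, h2, h3, h4.symm⟩

theorem IsArc.mem (ha : IsArcPattern n a) (h : IsArc n a e p q) : 1 ≤ p ∧ p ≤ n := by
  obtain ⟨i, h1, h2, h3, ⟨rfl, -⟩ | ⟨-, rfl⟩⟩ := h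
  · exact ha.mem i h1 h2.le
  · exact ha.mem (i + 1) (by omega) h2

theorem IsArc.unique (ha : IsArcPattern n a) {q' : ℕ} (h : IsArc n a e p q)
    (h' : IsArc n a e p q') : q = q' := by
  obtain ⟨i, h1, h2, h3, ⟨rfl, rfl⟩ | ⟨rfl, rfl⟩⟩ := h <;>
  obtain ⟨j, h1', h2', h3', ⟨h4, rfl⟩ | ⟨rfl, h4⟩⟩ := h'
  · rw [ha.inj j i h1' h2'.le h1 h2.le h4]
  · have := ha.inj (j + 1) i (by omega) h2' h1 h2.le h4
    omega
  · have := ha.inj j (i + 1) h1' h2'.le (by omega) h2 h4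
    omega
  · have := ha.inj (j + 1) (i + 1) (by omega) h2' (by omega) h2 h4
    rw [show j = i by omega]

theorem IsArc.exists_inside (ha : IsArcPattern n a) (h : IsArc n a e p q) {v : ℕ} (hpv : p < v)
    (hvq : v < q) : ∃ w, p < w ∧ w < q ∧ IsArc n a e v w := by
  have hp := h.mem ha
  have hq := h.symm.mem ha
  obtain ⟨i, h1, h2, h3, h4⟩ := h
  obtain ⟨k, hk, hkn, rfl⟩ := ha.surj (v := v) (by omega) (by omega)
  have hpq : ∀ x, (StrictlyBetween (a i) (a (i + 1)) x ↔ p < x ∧ x < q) := by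
    intro x
    rw [strictlyBetween_iff]
    omega
  have hhead := ha.head i h1 h2
  have hlast := ha.last i h1 h2
  have hnc : ∀ j, 1 ≤ j → j < n → i % 2 = j % 2 →
      ((p < a j ∧ a j < q) ↔ (p < a (j + 1) ∧ a (j + 1) < q)) := by
    intro j hj hjn hij
    have := ha.noncross i j h1 h2 hj hjn hij
    rw [arcsCross_iff, hpq, hpq] at this
    tauto
  rw [hpq] at hhead hlast
  by_cases hke : k % 2 = e
  · have hkn' : k ≠ n := by
      rintro rfl
      exact hlast (by omega) ⟨hpv, hvq⟩
    have := (hnc k hk (by omega) (by omega)).1 ⟨hpv, hvq⟩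
    exact ⟨a (k + 1), this.1, this.2, k, hk, by omega, hke, Or.inl ⟨rfl, rfl⟩⟩
  · have hk1 : k ≠ 1 := by
      rintro rfl
      exact hhead (by omega) ⟨hpv, hvq⟩
    obtain ⟨k, rfl⟩ : ∃ k', k = k' + 1 := ⟨k - 1, by omega⟩
    have := (hnc k (by omega) (by omega) (by omega)).2 ⟨hpv, hvq⟩
    exact ⟨a k, this.1, this.2, k, by omega, by omega, by omega, Or.inr ⟨rfl, rfl⟩⟩

theorem IsArc.transfer (ha : IsArcPattern n a) (ha' : IsArcPattern n a')
    (hl : ∀ v, IsLeftEnd n a e v ↔ IsLeftEnd n a' e v) (hpq : p < q) (h : IsArc n a e p q) :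
    IsArc n a' e p q := by
  induction hd : q - p using Nat.strong_induction_on generalizing p q with
  | _ d ih =>
    have inner : ∀ v, p < v → v < q → ∃ w, p < w ∧ w < q ∧ IsArc n a' e v w := by
      intro v hpv hvq
      obtain ⟨w, hw, hw', hvw⟩ := h.exists_inside ha hpv hvq
      rcases lt_trichotomy v w with hlt | rfl | hlt
      · exact ⟨w, hw, hw', ih (w - v) (by omega) hlt hvw rfl⟩
      · obtain ⟨i, h1, h2, -, h4⟩ := hvw
        have := ha.inj i (i + 1) h1 h2.le (by omega) h2 (by omega)
        omega
      · exact ⟨w, hw, hw', (ih (v - w) (by omega) hlt hvw.symm rfl).symm⟩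
    obtain ⟨q', hpq', h'⟩ := (hl p).1 ⟨q, hpq, h⟩
    rcases lt_trichotomy q' q with hlt | rfl | hlt
    · obtain ⟨w, hw, hw', hqw⟩ := inner q' hpq' hlt
      have := hqw.unique ha' h'.symm
      omega
    · exact h'
    · exfalso
      obtain ⟨w, hw, hw', hqw⟩ := h'.exists_inside ha' hpq hlt
      rcases lt_trichotomy q w with hqw' | rfl | hqw'
      · obtain ⟨w', hw1, hw2⟩ := (hl q).2 ⟨w, hqw', hqw⟩
        have := hw2.unique ha h.symm
        omega
      · obtain ⟨i, h1, h2, -, h4⟩ := hqw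
        have := ha'.inj i (i + 1) h1 h2.le (by omega) h2 (by omega)
        omega
      · obtain ⟨u, hu, hu', hwu⟩ := inner w hw hqw'
        have := hwu.unique ha' hqw.symm
        omega

/-- An arc pattern is determined by its first value and the left ends of its arcs. -/
theorem IsArcPattern.eq_of_leftEnds (ha : IsArcPattern n a) (ha' : IsArcPattern n a')
    (h1 : a 1 = a' 1) (hl : ∀ e v, IsLeftEnd n a e v ↔ IsLeftEnd n a' e v) {i : ℕ} (hi : 1 ≤ i)
    (hin : i ≤ n) : a i = a' i := by
  induction i, hi using Nat.le_induction with
  | base => exact h1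
  | succ i hi ih =>
    have ih := ih (by omega)
    have harc : IsArc n a (i % 2) (a i) (a (i + 1)) := ⟨i, hi, hin, rfl, Or.inl ⟨rfl, rfl⟩⟩
    have harc' : IsArc n a' (i % 2) (a i) (a (i + 1)) := by
      rcases lt_trichotomy (a i) (a (i + 1)) with hlt | heq | hlt
      · exact harc.transfer ha ha' (hl _) hlt
      · have := ha.inj i (i + 1) hi (by omega) (by omega) hin heq
        omega
      · exact (harc.symm.transfer ha ha' (hl _) hlt).symm
    rw [ih] at harc'
    exact harc'.unique ha' ⟨i, hi, hin, rfl, Or.inl ⟨rfl, rfl⟩⟩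

/-- A left end followed by something else closes an arc at once. -/
theorem IsArcPattern.isArc_succ (ha : IsArcPattern n a) (h : IsLeftEnd n a e p)
    (h' : ¬ IsLeftEnd n a e (p + 1)) : IsArc n a e p (p + 1) := by
  obtain ⟨q, hpq, hq⟩ := h
  rcases (show p + 1 ≤ q from hpq).eq_or_lt with rfl | hlt
  · exact hq
  · obtain ⟨w, hw, hw', hvw⟩ := hq.exists_inside ha (Nat.lt_succ_self p) hlt
    rcases (show p + 1 ≤ w from hw).eq_or_lt with rfl | hlt'
    · obtain ⟨i, h1, h2, -, h4⟩ := hvw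
      have := ha.inj i (i + 1) h1 h2.le (by omega) h2 (by omega)
      omega
    · exact absurd ⟨w, hlt', hvw⟩ h'

end Arcs

/-! ### Weighted words -/

/-- The number of places where `true` is followed, reading from the right, by `false`. -/
def descents : List Bool → ℕ
  | [] => 0
  | [_] => 0
  | false :: true :: l => descents (true :: l) + 1
  | false :: false :: l => descents (false :: l)
  | true :: b :: l => descents (b :: l)

/-- The values `g n, …, g 1`. -/
def wordOf (g : ℕ → Bool) : ℕ → List Bool
  | 0 => []
  | n + 1 => g (n + 1) :: wordOf g n

theorem descents_wordOf {g : ℕ → Bool} (h0 : g 0 = false) (n : ℕ) :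
    descents (wordOf g n) = ((Finset.range n).filter fun v => g v = true ∧ g (v + 1) = false).card := by
  induction n with
  | zero => simp [wordOf, descents]
  | succ n ih =>
    rw [Finset.range_add_one, Finset.filter_insert]
    cases n with
    | zero => simp [wordOf, descents, h0]
    | succ n =>
      rw [wordOf] at ih ⊢
      rw [wordOf]
      rcases h1 : g (n + 1) with _ | _ <;> rcases h2 : g (n + 1 + 1) with _ | _ <;>
        rw [h1] at ih <;> simp [descents, ih]

theorem wordOf_inj {g g' : ℕ → Bool} {n : ℕ} (h : wordOf g n = wordOf g' n) :
    ∀ v, 1 ≤ v → v ≤ n → g v = g' v := by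
  induction n with
  | zero => intro v h1 h2; omega
  | succ n ih =>
    rw [wordOf, wordOf, List.cons.injEq] at h
    intro v h1 h2
    rcases h2.eq_or_lt with rfl | h2
    · exact h.1
    · exact ih h.2 v h1 (by omega)

/-- All words of length `n`. -/
def words : ℕ → Finset (List Bool)
  | 0 => {[]}
  | n + 1 => (words n).image (List.cons true) ∪ (words n).image (List.cons false)

theorem wordOf_mem_words (g : ℕ → Bool) (n : ℕ) : wordOf g n ∈ words n := by
  induction n with
  | zero => simp [wordOf, words]
  | succ n ih =>
    rw [wordOf, words]
    cases g (n + 1) <;> simp [ih]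

theorem sum_words_succ (n : ℕ) (w : List Bool → ℝ) :
    ∑ l ∈ words (n + 1), w l = ∑ l ∈ words n, w (true :: l) + ∑ l ∈ words n, w (false :: l) := by
  rw [words, Finset.sum_union, Finset.sum_image, Finset.sum_image]
  · intro x _ y _ h
    simpa using h
  · intro x _ y _ h
    simpa using h
  · rw [Finset.disjoint_left]
    intro l h1 h2
    simp only [Finset.mem_image] at h1 h2
    obtain ⟨x, -, rfl⟩ := h1
    obtain ⟨y, -, h⟩ := h2
    simp at h

theorem sum_descents_le {z : ℝ} (hz : 0 < z) (hz1 : z ≤ 1) (n : ℕ) :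
    ∑ l ∈ words n, (z ^ 2) ^ descents (true :: l) ≤ (1 + z) ^ n / z ∧
      ∑ l ∈ words n, (z ^ 2) ^ descents (false :: l) ≤ (1 + z) ^ n := by
  induction n with
  | zero =>
    simp only [words, Finset.sum_singleton, descents, pow_zero, le_refl, and_true]
    exact (one_le_div hz).2 hz1
  | succ n ih =>
    obtain ⟨h1, h2⟩ := ih
    rw [sum_words_succ, sum_words_succ]
    simp only [descents, pow_succ _ (descents _), ← Finset.sum_mul]
    rw [div_eq_mul_inv] at *
    have hzz : z * z⁻¹ = 1 := mul_inv_cancel₀ hz.ne'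
    constructor
    · calc _ ≤ (1 + z) ^ n * z⁻¹ + (1 + z) ^ n := add_le_add h1 h2
        _ = (1 + z) ^ (n + 1) * z⁻¹ := by
          linear_combination (- (1 + z) ^ n) * hzz
    · calc _ ≤ ((1 + z) ^ n * z⁻¹) * z ^ 2 + (1 + z) ^ n :=
            add_le_add (mul_le_mul_of_nonneg_right h1 (by positivity)) h2
        _ = (1 + z) ^ (n + 1) := by
          linear_combination ((1 + z) ^ n * z) * hzz

theorem sum_words_le {z : ℝ} (hz : 0 < z) (hz1 : z ≤ 1) (n : ℕ) :
    ∑ l ∈ words n, (z ^ 2) ^ descents l ≤ (1 + z) ^ n / z := by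
  refine le_trans (le_of_eq (Finset.sum_congr rfl fun l _ => ?_)) (sum_descents_le hz hz1 n).1
  cases l <;> simp [descents]

/-! ### Finite sets of meanders -/

open Classical in
/-- The word recording the left ends of the arcs of type `e`. -/
noncomputable def leftWord (n : ℕ) (a : ℕ → ℕ) (e : ℕ) : List Bool :=
  wordOf (fun v => decide (IsLeftEnd n a e v)) n

/-- The number of descents of the two words of `a`. -/
noncomputable def arcDescents (n : ℕ) (a : ℕ → ℕ) : ℕ :=
  descents (leftWord n a 0) + descents (leftWord n a 1)

/-- Normalized open meandric permutations of order `n`. -/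
def meanderSet (n : ℕ) : Set (ℕ → ℕ) :=
  {a | IsOpenMeandricPerm n a ∧ ∀ i, i < 1 ∨ n < i → a i = 0}

/-- The first value and the two words of a meander. -/
noncomputable def meanderCode (n : ℕ) (a : ℕ → ℕ) : ℕ × List Bool × List Bool :=
  (a 1, leftWord n a 0, leftWord n a 1)

/-- The possible codes of meanders. -/
def meanderCodes (n : ℕ) : Finset (ℕ × List Bool × List Bool) :=
  Finset.Icc 1 n ×ˢ words n ×ˢ words n

theorem IsLeftEnd.mem {n : ℕ} {a : ℕ → ℕ} {e v : ℕ} (ha : IsArcPattern n a)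
    (h : IsLeftEnd n a e v) : 1 ≤ v ∧ v < n := by
  obtain ⟨q, hq, h⟩ := h
  have := h.mem ha
  have := h.symm.mem ha
  omega

theorem mapsTo_meanderCode (n : ℕ) :
    Set.MapsTo (meanderCode n) (meanderSet n) (meanderCodes n) := by
  intro a ha
  have ha := (isOpenMeandricPerm_iff.1 ha.1).1
  simp only [meanderCode, meanderCodes, Finset.coe_product, Set.mem_prod, Finset.mem_coe,
    Finset.mem_Icc]
  exact ⟨ha.mem 1 le_rfl ha.pos, wordOf_mem_words _ _, wordOf_mem_words _ _⟩

theorem injOn_meanderCode (n : ℕ) : Set.InjOn (meanderCode n) (meanderSet n) := by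
  intro a ha b hb hab
  obtain ⟨ha, ha0⟩ := ha
  obtain ⟨hb, hb0⟩ := hb
  have ha := (isOpenMeandricPerm_iff.1 ha).1
  have hb := (isOpenMeandricPerm_iff.1 hb).1
  simp only [meanderCode, Prod.mk.injEq] at hab
  obtain ⟨h1, h2, h3⟩ := hab
  have key : ∀ e v, IsLeftEnd n a e v ↔ IsLeftEnd n b e v := by
    intro e v
    by_cases hv : 1 ≤ v ∧ v ≤ n
    · have aux : e = 0 ∨ e = 1 ∨ 2 ≤ e := by omega
      rcases aux with rfl | rfl | he
      · simpa using wordOf_inj h2 v hv.1 hv.2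
      · simpa using wordOf_inj h3 v hv.1 hv.2
      · constructor <;> rintro ⟨q, -, i, -, -, h, -⟩ <;> omega
    · constructor <;> intro h
      · have := h.mem ha
        omega
      · have := h.mem hb
        omega
  funext i
  by_cases hi : 1 ≤ i ∧ i ≤ n
  · exact ha.eq_of_leftEnds hb h1 key hi.1 hi.2
  · rw [ha0 i (by omega), hb0 i (by omega)]

theorem finite_meanderSet (n : ℕ) : (meanderSet n).Finite :=
  Set.Finite.of_injOn (mapsTo_meanderCode n) (injOn_meanderCode n) (meanderCodes n).finite_toSet

/-- Normalized open meandric permutations of order `n`, as a finite set. -/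
noncomputable def meanders (n : ℕ) : Finset (ℕ → ℕ) := (finite_meanderSet n).toFinset

theorem mem_meanders {n : ℕ} {a : ℕ → ℕ} :
    a ∈ meanders n ↔ IsOpenMeandricPerm n a ∧ ∀ i, i < 1 ∨ n < i → a i = 0 := by
  simp [meanders, meanderSet]

theorem openMeanderCount_eq (n : ℕ) : openMeanderCount n = (meanders n).card :=
  Set.ncard_eq_toFinset_card _ (finite_meanderSet n)

open Classical in
theorem irrMeanderCount_eq (n : ℕ) :
    irrMeanderCount n = ((meanders n).filter (IsIrreducibleMeander n)).card := by
  rw [← Set.ncard_coe_finset, irrMeanderCount]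
  congr 1
  ext a
  simp only [Set.mem_ofPred_eq, Finset.coe_filter, mem_meanders]
  tauto

theorem sum_arcDescents_le {z : ℝ} (hz : 0 < z) (hz1 : z ≤ 1) (n : ℕ) :
    ∑ a ∈ meanders n, (z ^ 2) ^ arcDescents n a ≤ n * ((1 + z) ^ n / z) ^ 2 := by
  have h1 : ∑ a ∈ meanders n, (z ^ 2) ^ arcDescents n a =
      ∑ c ∈ (meanders n).image (meanderCode n),
        (z ^ 2) ^ descents c.2.1 * (z ^ 2) ^ descents c.2.2 := by
    rw [Finset.sum_image]
    · exact Finset.sum_congr rfl fun a _ => pow_add _ _ _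
    · intro a ha b hb
      exact injOn_meanderCode n (mem_meanders.1 ha) (mem_meanders.1 hb)
  rw [h1]
  refine (Finset.sum_le_sum_of_subset_of_nonneg (t := meanderCodes n) ?_
    fun c _ _ => by positivity).trans ?_
  · intro c hc
    obtain ⟨a, ha, rfl⟩ := Finset.mem_image.1 hc
    exact mapsTo_meanderCode n (mem_meanders.1 ha)
  · have h0 : 0 ≤ ∑ l ∈ words n, (z ^ 2) ^ descents l :=
      Finset.sum_nonneg fun _ _ => by positivity
    have h2 := sum_words_le hz hz1 n
    simp only [meanderCodes, Finset.sum_product, ← Finset.mul_sum, ← Finset.sum_mul,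
      Finset.sum_const, Nat.card_Icc, add_tsub_cancel_right, nsmul_eq_mul]
    generalize ∑ l ∈ words n, (z ^ 2) ^ descents l = S at h0 h2
    calc _ = (n : ℝ) * S ^ 2 := by ring
      _ ≤ _ := by gcongr

theorem card_meanders_le (n : ℕ) : ((meanders n).card : ℝ) ≤ n * 4 ^ n := by
  have := sum_arcDescents_le one_pos le_rfl n
  norm_num [← pow_mul, mul_comm n 2] at this
  rw [pow_mul] at this
  norm_num at this
  exact this

theorem card_meanders_pos {n : ℕ} (hn : 1 ≤ n) : 1 ≤ (meanders n).card := by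
  refine Finset.card_pos.2 ⟨fun i => if 1 ≤ i ∧ i ≤ n then i else 0, mem_meanders.2 ⟨?_, ?_⟩⟩
  · refine isOpenMeandricPerm_iff.2 ⟨⟨hn, ?_, ?_, ?_, ?_, ?_⟩, ?_⟩
    · intro i h1 h2
      rw [if_pos ⟨h1, h2⟩]
      omega
    · intro i j h1 h2 h3 h4 h
      rwa [if_pos ⟨h1, h2⟩, if_pos ⟨h3, h4⟩] at h
    · intro i j h1 h2 h3 h4 h
      rw [if_pos (by omega), if_pos (by omega), if_pos (by omega), if_pos (by omega),
        arcsCross_iff]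
      simp only [strictlyBetween_iff]
      omega
    · intro i h1 h2 h
      rw [if_pos (by omega), if_pos (by omega), if_pos (by omega), strictlyBetween_iff]
      omega
    · intro i h1 h2 h
      rw [if_pos (by omega), if_pos (by omega), if_pos (by omega), strictlyBetween_iff]
      omega
    · intro i h1 h2
      rw [if_pos ⟨h1, h2⟩]
  · intro i hi
    rw [if_neg (by omega)]

/-! ### Descents of inflations -/

theorem arcDescents_le {n : ℕ} {a : ℕ → ℕ} (ha : IsArcPattern n a) :
    arcDescents n a ≤
      ((Finset.Ico 1 n).filter fun i => a i = a (i + 1) + 1 ∨ a (i + 1) = a i + 1).card := by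
  classical
  have key : ∀ e, descents (leftWord n a e) ≤ (((Finset.Ico 1 n).filter fun i =>
      a i = a (i + 1) + 1 ∨ a (i + 1) = a i + 1).filter fun i => i % 2 = e).card := by
    intro e
    rw [leftWord, descents_wordOf]
    · refine (Finset.card_le_card (t := Finset.image (fun i => min (a i) (a (i + 1)))
        (((Finset.Ico 1 n).filter fun i =>
          a i = a (i + 1) + 1 ∨ a (i + 1) = a i + 1).filter fun i => i % 2 = e)) ?_).trans
        Finset.card_image_le
      intro v hv
      simp only [Finset.mem_filter, decide_eq_true_eq, decide_eq_false_iff_not] at hv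
      obtain ⟨i, h1, h2, h3, h4⟩ := ha.isArc_succ hv.2.1 hv.2.2
      refine Finset.mem_image.2 ⟨i, ?_, ?_⟩
      · simp only [Finset.mem_filter, Finset.mem_Ico]
        omega
      · rcases h4 with h4 | h4 <;> rw [h4.1, h4.2] <;> simp
    · simp only [decide_eq_false_iff_not]
      intro h
      have := h.mem ha
      omega
  have h0 := key 0
  have h1 := key 1
  rw [← Finset.card_filter_add_card_filter_not (fun i => i % 2 = 0)]
  simp only [Nat.mod_two_not_eq_zero]
  exact add_le_add h0 h1

theorem arcDescents_inflate_le {K : ℕ} {π : ℕ → ℕ} {f : ℕ → List ℕ} (hK : 3 ≤ K)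
    (hf : ∀ s < K, IsArcList (f s)) (hlen : ∀ s < K, (f s).length ≤ 2) (hsimp : IsSimple K π)
    (ha : IsArcPattern (posOffset f K) (inflate K π f)) :
    arcDescents (posOffset f K) (inflate K π f) ≤
      ((Finset.range K).filter fun s => (f s).length = 2).card := by
  refine (arcDescents_le ha).trans ((Finset.card_le_card (t := Finset.image
    (fun s => posOffset f s + 1) ((Finset.range K).filter fun s => (f s).length = 2)) ?_).trans
    Finset.card_image_le)
  intro i hi
  simp only [Finset.mem_filter, Finset.mem_Ico] at hi
  obtain ⟨⟨h1, h2⟩, h3⟩ := hi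
  have hb : IsBlock (posOffset f K) (inflate K π f) i (i + 1) := by
    refine ⟨h1, by omega, h2, fun k _ _ _ p q hp hp' hq hq' => ?_⟩
    have hp : p = i ∨ p = i + 1 := by omega
    have hq : q = i ∨ q = i + 1 := by omega
    rcases hp with rfl | rfl <;> rcases hq with rfl | rfl <;> omega
  have hlong : 3 ≤ posOffset f K := by
    have h0 := (hf 0 (by omega)).pos
    have h1 := (hf 1 (by omega)).pos
    have h2 := (hf 2 (by omega)).pos
    have := posOffset_mono f hK
    rw [posOffset_succ, posOffset_succ, posOffset_succ] at this
    omega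
  obtain ⟨s, hs, hsi, his⟩ := exists_site_of_isBlock hK hf hsimp hb (by omega)
  have := hlen s hs
  rw [posOffset_succ] at his
  refine Finset.mem_image.2 ⟨s, ?_, by omega⟩
  simp only [Finset.mem_filter, Finset.mem_range]
  exact ⟨hs, by omega⟩

/-! ### Weighted counting of inflations -/

/-- Extend a tuple of lists by empty lists. -/
def extendTuple {K : ℕ} (f : Fin K → List ℕ) (s : ℕ) : List ℕ :=
  if h : s < K then f ⟨s, h⟩ else []

theorem extendTuple_fin {K : ℕ} (f : Fin K → List ℕ) (s : Fin K) : extendTuple f s = f s := by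
  simp [extendTuple]

theorem extendTuple_of_lt {K : ℕ} (f : Fin K → List ℕ) {s : ℕ} (hs : s < K) :
    extendTuple f s = f ⟨s, hs⟩ := by
  simp [extendTuple, hs]

theorem posOffset_extendTuple {K : ℕ} (f : Fin K → List ℕ) :
    posOffset (extendTuple f) K = ∑ s, (f s).length := by
  rw [posOffset, ← Fin.sum_univ_eq_sum_range fun t => (extendTuple f t).length]
  simp only [extendTuple_fin]

/-- Weights of site kinds for which the kinds of lists substituting for the same list have total
weight at most one. -/
structure IsKindWeight (q : List ℕ → ℝ) : Prop where
  nonneg : ∀ k, 0 ≤ q k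
  odd : q [1] + q [1, 2, 3] + q [3, 2, 1] ≤ 1
  up : q [1, 2] ≤ 1
  down : q [2, 1] ≤ 1

open Classical in
theorem IsKindWeight.sum_le {q : List ℕ → ℝ} (hq : IsKindWeight q) (l : List ℕ) :
    ∑ k ∈ siteKinds.filter (fun k => IsCompatible k l), q k ≤ 1 := by
  have main : ∀ T : Finset (List ℕ), siteKinds.filter (fun k => IsCompatible k l) ⊆ T →
      ∑ k ∈ T, q k ≤ 1 → ∑ k ∈ siteKinds.filter (fun k => IsCompatible k l), q k ≤ 1 :=
    fun T hT h => (Finset.sum_le_sum_of_subset_of_nonneg hT fun k _ _ => hq.nonneg k).trans h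
  have hmem : ∀ k ∈ siteKinds.filter (fun k => IsCompatible k l), IsCompatible k l ∧
      (k = [1] ∨ k = [1, 2, 3] ∨ k = [3, 2, 1] ∨ k = [1, 2] ∨ k = [2, 1]) := by
    intro k hk
    simp only [Finset.mem_filter, siteKinds, Finset.mem_insert, Finset.mem_singleton] at hk
    exact ⟨hk.2, hk.1⟩
  rcases Nat.mod_two_eq_zero_or_one l.length with h | h
  · by_cases h1 : entry l 1 % 2 = 1
    · refine main {[1, 2]} (fun k hk => ?_) (by simpa using hq.up)
      obtain ⟨hc, hk⟩ := hmem k hk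
      have h2 := hc.parity
      have h3 := hc.entry_parity 1 le_rfl hc.arcs.pos
      rcases hk with rfl | rfl | rfl | rfl | rfl <;> (simp_all [entry]; try omega)
    · refine main {[2, 1]} (fun k hk => ?_) (by simpa using hq.down)
      obtain ⟨hc, hk⟩ := hmem k hk
      have h2 := hc.parity
      have h3 := hc.entry_parity 1 le_rfl hc.arcs.pos
      rcases hk with rfl | rfl | rfl | rfl | rfl <;> (simp_all [entry]; try omega)
  · refine main {[1], [1, 2, 3], [3, 2, 1]} (fun k hk => ?_) ?_
    · obtain ⟨hc, hk⟩ := hmem k hk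
      have h2 := hc.parity
      rcases hk with rfl | rfl | rfl | rfl | rfl <;> simp_all
    · have := hq.odd
      simp
      linarith

theorem isArcList_of_mem_siteKinds : ∀ k ∈ siteKinds, IsArcList k := by
  intro k hk
  refine (CompatibilityCheck.isCompatible (k := k) (l := k) ?_).arcs
  revert k
  decide

theorem sum_inflations_le {N : ℕ} {I : Finset (ℕ → ℕ)} {K : (ℕ → ℕ) → ℕ}
    {π : (ℕ → ℕ) → ℕ → ℕ} {κ : (ℕ → ℕ) → ℕ → List ℕ}
    (hI : ∀ a ∈ I, IsOpenMeandricPerm N a ∧ 3 ≤ K a ∧ Set.InjOn (π a) (Set.Iio (K a)) ∧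
      IsSimple (K a) (π a) ∧ (∀ s < K a, κ a s ∈ siteKinds) ∧ posOffset (κ a) (K a) = N ∧
      inflate (K a) (π a) (κ a) = a)
    {Pat : List ℕ → Finset (List ℕ)}
    (hPat : ∀ k ∈ siteKinds, ∀ l ∈ Pat k, IsCompatible k l ∧ l.length ≤ 8)
    {q : List ℕ → ℝ} (hq : IsKindWeight q) {W : ℕ → (ℕ → ℕ) → ℝ} (hW : ∀ m b, 0 ≤ W m b) :
    ∑ a ∈ I, ∑ f ∈ Fintype.piFinset (fun s : Fin (K a) => Pat (κ a s)),
      (∏ s : Fin (K a), q (κ a s)) *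
        W (posOffset (extendTuple f) (K a)) (inflate (K a) (π a) (extendTuple f)) ≤
      ∑ m ∈ Finset.range (8 * N + 1), ∑ b ∈ meanders m, W m b := by
  classical
  set Φ : (Σ a : ℕ → ℕ, Fin (K a) → List ℕ) → (Σ _ : ℕ, ℕ → ℕ) := fun p =>
    ⟨posOffset (extendTuple p.2) (K p.1), inflate (K p.1) (π p.1) (extendTuple p.2)⟩ with hΦ
  set S := I.sigma fun a => Fintype.piFinset (fun s : Fin (K a) => Pat (κ a s)) with hS
  have hmem : ∀ p ∈ S, p.1 ∈ I ∧ (∀ s < K p.1, κ p.1 s ∈ siteKinds) ∧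
      ∀ s < K p.1, IsCompatible (κ p.1 s) (extendTuple p.2 s) ∧ (extendTuple p.2 s).length ≤ 8 := by
    intro p hp
    simp only [hS, Finset.mem_sigma, Fintype.mem_piFinset] at hp
    have := (hI p.1 hp.1).2.2.2.2.1
    refine ⟨hp.1, this, fun s hs => hPat _ (this s hs) _ ?_⟩
    rw [extendTuple_of_lt _ hs]
    exact hp.2 ⟨s, hs⟩
  have hkind := isArcList_of_mem_siteKinds
  have hmaps : ∀ p ∈ S, Φ p ∈ (Finset.range (8 * N + 1)).sigma meanders := by
    intro p hp
    obtain ⟨h1, h2, h3⟩ := hmem p hp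
    obtain ⟨ha, hK, hπ, hsimp, -, hN, hinf⟩ := hI _ h1
    refine Finset.mem_sigma.2 ⟨?_, mem_meanders.2 ⟨?_, fun i hi => inflate_outside hi⟩⟩
    · simp only [Finset.mem_range, Nat.lt_succ_iff, hΦ]
      rw [← hN, posOffset, posOffset, Finset.mul_sum]
      refine Finset.sum_le_sum fun s hs => ?_
      have h4 := (h3 s (Finset.mem_range.1 hs)).2
      have h5 := (hkind _ (h2 s (Finset.mem_range.1 hs))).pos
      omega
    · refine isOpenMeandricPerm_inflate (by omega) hπ (fun s hs => hkind _ (h2 s hs))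
        (fun s hs => (h3 s hs).1) ?_
      rwa [hN, hinf]
  have hfib : ∀ c ∈ (Finset.range (8 * N + 1)).sigma meanders,
      ∑ p ∈ S with Φ p = c, ∏ s : Fin (K p.1), q (κ p.1 s) ≤ 1 := by
    intro c _
    rcases (S.filter fun p => Φ p = c).eq_empty_or_nonempty with h0 | ⟨p₀, hp₀⟩
    · simp [h0]
    have hp₀ := Finset.mem_filter.1 hp₀
    obtain ⟨h1, h2, h3⟩ := hmem _ hp₀.1
    obtain ⟨ha, hK, hπ, hsimp, -, hN, hinf⟩ := hI _ h1
    have huniq : ∀ p ∈ S.filter (fun p => Φ p = c), K p.1 = K p₀.1 ∧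
        (∀ s < K p₀.1, extendTuple p.2 s = extendTuple p₀.2 s) ∧
        ∀ s < K p₀.1, ∀ t < K p₀.1, (π p.1 s < π p.1 t ↔ π p₀.1 s < π p₀.1 t) := by
      intro p hp
      obtain ⟨hp, hpc⟩ := Finset.mem_filter.1 hp
      obtain ⟨h1', h2', h3'⟩ := hmem _ hp
      obtain ⟨ha', hK', hπ', hsimp', -, hN', hinf'⟩ := hI _ h1'
      have heq := hpc.trans hp₀.2.symm
      simp only [hΦ, Sigma.mk.injEq, heq_eq_eq] at heq
      have := inflate_unique hK' hK hπ' hπ (fun s hs => (h3' s hs).1.arcs)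
        (fun s hs => (h3 s hs).1.arcs) hsimp' hsimp heq.2
      exact ⟨this.1, fun s hs => this.2.1 s (by omega),
        fun s hs t ht => this.2.2 s (by omega) t (by omega)⟩
    set ψ : (Σ a : ℕ → ℕ, Fin (K a) → List ℕ) → Fin (K p₀.1) → List ℕ :=
      fun p s => κ p.1 s with hψ
    calc _ = ∑ p ∈ S with Φ p = c, ∏ s : Fin (K p₀.1), q (ψ p s) := by
          refine Finset.sum_congr rfl fun p hp => ?_
          rw [Fin.prod_univ_eq_prod_range (fun s => q (κ p.1 s)), (huniq p hp).1,
            ← Fin.prod_univ_eq_prod_range (fun s => q (κ p.1 s))]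
      _ = ∑ x ∈ (S.filter fun p => Φ p = c).image ψ, ∏ s : Fin (K p₀.1), q (x s) := by
          rw [Finset.sum_image]
          intro p hp p' hp' hpp
          obtain ⟨k1, k2, k3⟩ := huniq p hp
          obtain ⟨k1', k2', k3'⟩ := huniq p' hp'
          obtain ⟨h1, -, -⟩ := hmem _ (Finset.mem_filter.1 hp).1
          obtain ⟨h1', -, -⟩ := hmem _ (Finset.mem_filter.1 hp').1
          have e1 := (hI _ h1).2.2.2.2.2.2
          have e2 := (hI _ h1').2.2.2.2.2.2
          have hfst : p.1 = p'.1 := by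
            rw [← e1, ← e2, k1, k1']
            refine inflate_congr (fun s hs t ht => (k3 s hs t ht).trans (k3' s hs t ht).symm) ?_
            intro s hs
            exact congrFun hpp ⟨s, hs⟩
          obtain ⟨a, f⟩ := p
          obtain ⟨a', f'⟩ := p'
          obtain rfl : a = a' := hfst
          congr 1
          funext s
          have := (k2 s (by rw [← k1]; exact s.2)).trans (k2' s (by rw [← k1]; exact s.2)).symm
          rwa [extendTuple_fin, extendTuple_fin] at this
      _ ≤ ∑ x ∈ Fintype.piFinset fun s : Fin (K p₀.1) =>
            siteKinds.filter (fun k => IsCompatible k (p₀.2 s)), ∏ s, q (x s) := by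
          refine Finset.sum_le_sum_of_subset_of_nonneg ?_
            fun x _ _ => Finset.prod_nonneg fun s _ => hq.nonneg _
          intro x hx
          obtain ⟨p, hp, rfl⟩ := Finset.mem_image.1 hx
          obtain ⟨k1, k2, k3⟩ := huniq p hp
          obtain ⟨-, h2', h3'⟩ := hmem _ (Finset.mem_filter.1 hp).1
          refine Fintype.mem_piFinset.2 fun s => Finset.mem_filter.2
            ⟨h2' s (by rw [k1]; exact s.2), ?_⟩
          have := (h3' s (by rw [k1]; exact s.2)).1
          rwa [k2 s s.2, extendTuple_fin] at this
      _ = ∏ s : Fin (K p₀.1), ∑ k ∈ siteKinds.filter (fun k => IsCompatible k (p₀.2 s)), q k := by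
          rw [Finset.prod_univ_sum]
      _ ≤ 1 := Finset.prod_le_one (fun s _ => Finset.sum_nonneg fun k _ => hq.nonneg k)
          fun s _ => hq.sum_le _
  calc _ = ∑ p ∈ S, (∏ s : Fin (K p.1), q (κ p.1 s)) * W (Φ p).1 (Φ p).2 := by
        rw [hS, Finset.sum_sigma]
    _ = ∑ c ∈ (Finset.range (8 * N + 1)).sigma meanders, ∑ p ∈ S with Φ p = c,
          (∏ s : Fin (K p.1), q (κ p.1 s)) * W (Φ p).1 (Φ p).2 :=
        (Finset.sum_fiberwise_of_maps_to hmaps _).symm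
    _ ≤ ∑ c ∈ (Finset.range (8 * N + 1)).sigma meanders, W c.1 c.2 := by
        refine Finset.sum_le_sum fun c hc => ?_
        calc _ = (∑ p ∈ S with Φ p = c, ∏ s : Fin (K p.1), q (κ p.1 s)) * W c.1 c.2 := by
              rw [Finset.sum_mul]
              refine Finset.sum_congr rfl fun p hp => ?_
              rw [(Finset.mem_filter.1 hp).2]
          _ ≤ 1 * W c.1 c.2 := mul_le_mul_of_nonneg_right (hfib c hc) (hW _ _)
          _ = _ := one_mul _
    _ = _ := Finset.sum_sigma _ _ _

/-! ### Two estimates for site weights -/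

/-- Normalized irreducible open meandric permutations. -/
noncomputable def irrMeanders (n : ℕ) : Finset (ℕ → ℕ) :=
  open Classical in (meanders n).filter (IsIrreducibleMeander n)

theorem sum_prod_le {N : ℕ} {I : Finset (ℕ → ℕ)} {K : (ℕ → ℕ) → ℕ}
    {π : (ℕ → ℕ) → ℕ → ℕ} {κ : (ℕ → ℕ) → ℕ → List ℕ}
    (hI : ∀ a ∈ I, IsOpenMeandricPerm N a ∧ 3 ≤ K a ∧ Set.InjOn (π a) (Set.Iio (K a)) ∧
      IsSimple (K a) (π a) ∧ (∀ s < K a, κ a s ∈ siteKinds) ∧ posOffset (κ a) (K a) = N ∧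
      inflate (K a) (π a) (κ a) = a)
    {Pat : List ℕ → Finset (List ℕ)}
    (hPat : ∀ k ∈ siteKinds, ∀ l ∈ Pat k, IsCompatible k l ∧ l.length ≤ 8)
    {q : List ℕ → ℝ} (hq : IsKindWeight q) {W : ℕ → (ℕ → ℕ) → ℝ} (hW : ∀ m b, 0 ≤ W m b)
    {v : List ℕ → ℝ}
    (hv : ∀ a ∈ I, ∀ f ∈ Fintype.piFinset (fun s : Fin (K a) => Pat (κ a s)),
      ∏ s, v (f s) ≤ W (posOffset (extendTuple f) (K a)) (inflate (K a) (π a) (extendTuple f))) :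
    ∑ a ∈ I, ∏ s ∈ Finset.range (K a), (q (κ a s) * ∑ l ∈ Pat (κ a s), v l) ≤
      ∑ m ∈ Finset.range (8 * N + 1), ∑ b ∈ meanders m, W m b := by
  refine le_trans (Finset.sum_le_sum fun a ha => ?_) (sum_inflations_le hI hPat hq hW)
  rw [← Fin.prod_univ_eq_prod_range (fun s => q (κ a s) * ∑ l ∈ Pat (κ a s), v l),
    Finset.prod_mul_distrib, Finset.prod_univ_sum, Finset.mul_sum]
  exact Finset.sum_le_sum fun f hf =>
    mul_le_mul_of_nonneg_left (hv a ha f hf) (Finset.prod_nonneg fun s _ => hq.nonneg _)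

/-- The weights of site kinds for which a run of three has weight `t` times that of a single. -/
noncomputable def kindWeight (t : ℝ) (k : List ℕ) : ℝ :=
  if k.length = 1 then 1 / (1 + 2 * t) else if k.length = 3 then t / (1 + 2 * t) else 1

theorem isKindWeight_kindWeight {t : ℝ} (ht : 0 ≤ t) : IsKindWeight (kindWeight t) := by
  refine ⟨fun k => ?_, ?_, ?_, ?_⟩
  · unfold kindWeight
    split_ifs <;> positivity
  · simp only [kindWeight]
    norm_num
    rw [← one_div, ← add_div, ← add_div, div_le_one (by positivity)]
    linarith
  · simp [kindWeight]
  · simp [kindWeight]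

theorem sum_patternList (k : List ℕ) (h : (patternList k).Nodup) (x : ℝ) :
    ∑ l ∈ (patternList k).toFinset, x ^ l.length =
      (((patternList k).map List.length).map fun i => x ^ i).sum := by
  rw [List.sum_toFinset _ h, List.map_map]
  rfl

/-- The weight of a site when substituting lists from `patternList`. -/
noncomputable def patternWeight (x t : ℝ) (k : List ℕ) : ℝ :=
  kindWeight t k * ∑ l ∈ (patternList k).toFinset, x ^ l.length

theorem patternWeight_eq (x t : ℝ) :
    patternWeight x t [1] = (x + 2 * x ^ 3 + 8 * x ^ 5 + 42 * x ^ 7) / (1 + 2 * t) ∧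
    patternWeight x t [1, 2, 3] = t * (x + 2 * x ^ 3 + 8 * x ^ 5 + 42 * x ^ 7) / (1 + 2 * t) ∧
    patternWeight x t [3, 2, 1] = t * (x + 2 * x ^ 3 + 8 * x ^ 5 + 42 * x ^ 7) / (1 + 2 * t) ∧
    patternWeight x t [1, 2] = x ^ 2 + 3 * x ^ 4 + 14 * x ^ 6 + 81 * x ^ 8 ∧
    patternWeight x t [2, 1] = x ^ 2 + 3 * x ^ 4 + 14 * x ^ 6 + 81 * x ^ 8 := by
  have ho := lengths_patternList_odd
  have he := lengths_patternList_even
  have h1 := ho [1] (by simp)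
  have h2 := ho [1, 2, 3] (by simp)
  have h3 := ho [3, 2, 1] (by simp)
  have h4 := he [1, 2] (by simp)
  have h5 := he [2, 1] (by simp)
  refine ⟨?_, ?_, ?_, ?_, ?_⟩
  · rw [patternWeight, sum_patternList _ h1.2, h1.1]
    simp [kindWeight]
    ring
  · rw [patternWeight, sum_patternList _ h2.2, h2.1]
    simp [kindWeight]
    ring
  · rw [patternWeight, sum_patternList _ h3.2, h3.1]
    simp [kindWeight]
    ring
  · rw [patternWeight, sum_patternList _ h4.2, h4.1]
    simp [kindWeight]
    ring
  · rw [patternWeight, sum_patternList _ h5.2, h5.1]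
    simp [kindWeight]
    ring

/-- The shortest list that may be substituted for `k`. -/
def shortest (k : List ℕ) : List ℕ := if k.length % 2 = 1 then [1] else k

/-- The contribution of a substituted list when counting with weights on descents. -/
noncomputable def descentWeight (l : List ℕ) : ℝ :=
  (if l.length = 2 then (1 / 25 : ℝ) else 1) * (25 / 36) ^ l.length

/-- The weight of a site when substituting shortest lists. -/
noncomputable def shortestWeight (t : ℝ) (k : List ℕ) : ℝ :=
  kindWeight t k * ∑ l ∈ ({shortest k} : Finset (List ℕ)), descentWeight l

theorem shortestWeight_eq (t : ℝ) :
    shortestWeight t [1] = 25 / 36 / (1 + 2 * t) ∧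
    shortestWeight t [1, 2, 3] = t * (25 / 36) / (1 + 2 * t) ∧
    shortestWeight t [3, 2, 1] = t * (25 / 36) / (1 + 2 * t) ∧
    shortestWeight t [1, 2] = 25 / 1296 ∧
    shortestWeight t [2, 1] = 25 / 1296 := by
  refine ⟨?_, ?_, ?_, ?_, ?_⟩ <;> simp [shortestWeight, shortest, descentWeight, kindWeight] <;>
    ring

theorem mem_patterns : ∀ k ∈ siteKinds, ∀ l ∈ (patternList k).toFinset,
    IsCompatible k l ∧ l.length ≤ 8 := by
  intro k hk l hl
  rw [List.mem_toFinset] at hl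
  refine ⟨isCompatible_of_mem_patternList hl, ?_⟩
  have h : l.length ∈ (patternList k).map List.length := List.mem_map_of_mem hl
  simp only [siteKinds, Finset.mem_insert, Finset.mem_singleton] at hk
  by_cases ho : k ∈ ([[1], [1, 2, 3], [3, 2, 1]] : List (List ℕ))
  · rw [(lengths_patternList_odd k ho).1] at h
    simp only [List.mem_append, List.mem_replicate] at h
    omega
  · have he : k ∈ ([[1, 2], [2, 1]] : List (List ℕ)) := by
      simp only [List.mem_cons, List.not_mem_nil, or_false] at ho ⊢
      tauto
    rw [(lengths_patternList_even k he).1] at h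
    simp only [List.mem_append, List.mem_replicate] at h
    omega

theorem compatible_shortest : ∀ k ∈ siteKinds, IsCompatible k (shortest k) ∧
    (shortest k).length ≤ 2 := by
  intro k hk
  have : CompatibilityCheck k (shortest k) ∧ (shortest k).length ≤ 2 := by
    revert k
    decide
  exact ⟨this.1.isCompatible, this.2⟩

theorem exists_site_weights {N : ℕ} (hN : 7 ≤ N) :
    ∃ (K : (ℕ → ℕ) → ℕ) (κ : (ℕ → ℕ) → ℕ → List ℕ),
      (∀ a ∈ irrMeanders N, (∀ s < K a, κ a s ∈ siteKinds) ∧ posOffset (κ a) (K a) = N) ∧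
      (∀ x t : ℝ, 0 ≤ x → 0 ≤ t →
        ∑ a ∈ irrMeanders N, ∏ s ∈ Finset.range (K a), patternWeight x t (κ a s) ≤
          ∑ m ∈ Finset.range (8 * N + 1), (openMeanderCount m : ℝ) * x ^ m) ∧
      ∀ t : ℝ, 0 ≤ t →
        ∑ a ∈ irrMeanders N, ∏ s ∈ Finset.range (K a), shortestWeight t (κ a s) ≤
          ∑ m ∈ Finset.range (8 * N + 1), 25 * (m : ℝ) := by
  classical
  have hdec : ∀ a, ∃ (K : ℕ) (π : ℕ → ℕ) (κ : ℕ → List ℕ), a ∈ irrMeanders N →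
      IsOpenMeandricPerm N a ∧ 3 ≤ K ∧ Set.InjOn π (Set.Iio K) ∧ IsSimple K π ∧
      (∀ s < K, κ s ∈ siteKinds) ∧ posOffset κ K = N ∧ inflate K π κ = a := by
    intro a
    by_cases ha : a ∈ irrMeanders N
    · have h := Finset.mem_filter.1 ha
      have h' := mem_meanders.1 h.1
      obtain ⟨K, π, κ, hd⟩ := exists_decomposition hN h'.1 h.2 h'.2
      exact ⟨K, π, κ, fun _ => ⟨h'.1, hd⟩⟩
    · exact ⟨0, id, fun _ => [], fun h => absurd h ha⟩
  choose K π κ hI using hdec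
  refine ⟨K, κ, fun a ha => ⟨(hI a ha).2.2.2.2.1, (hI a ha).2.2.2.2.2.1⟩, fun x t hx ht => ?_,
    fun t ht => ?_⟩
  · refine (sum_prod_le hI mem_patterns (isKindWeight_kindWeight ht) (W := fun m _ => x ^ m)
      (fun m b => by positivity) (v := fun l => x ^ l.length) fun a ha f hf => ?_).trans ?_
    · rw [posOffset_extendTuple, Finset.prod_pow_eq_pow_sum]
    · simp [openMeanderCount_eq]
  · refine (sum_prod_le hI (Pat := fun k => {shortest k}) ?_ (isKindWeight_kindWeight ht)
      (W := fun m b => (1 / 25 : ℝ) ^ arcDescents m b * (25 / 36) ^ m)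
      (fun m b => by positivity) (v := descentWeight) fun a ha f hf => ?_).trans ?_
    · intro k hk l hl
      rw [Finset.mem_singleton] at hl
      subst hl
      have := compatible_shortest k hk
      exact ⟨this.1, by omega⟩
    · obtain ⟨hm, hK, hπ, hsimp, hκ, hn, hinf⟩ := hI a ha
      have hf' : ∀ s < K a, extendTuple f s = shortest (κ a s) := by
        intro s hs
        rw [extendTuple_of_lt _ hs]
        simpa using Fintype.mem_piFinset.1 hf ⟨s, hs⟩
      have hc : ∀ s < K a, IsCompatible (κ a s) (extendTuple f s) := fun s hs => by
        rw [hf' s hs]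
        exact (compatible_shortest _ (hκ s hs)).1
      have hl : ∀ s < K a, (extendTuple f s).length ≤ 2 := fun s hs => by
        rw [hf' s hs]
        exact (compatible_shortest _ (hκ s hs)).2
      have hopen := isOpenMeandricPerm_inflate (by omega) hπ (fun s hs => isArcList_of_mem_siteKinds _ (hκ s hs)) hc
        (by rwa [hn, hinf])
      have hd := arcDescents_inflate_le hK (fun s hs => (hc s hs).arcs) hl hsimp
        (isOpenMeandricPerm_iff.1 hopen).1
      calc ∏ s, descentWeight (f s)
          = ∏ s ∈ Finset.range (K a), descentWeight (extendTuple f s) := by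
            rw [← Fin.prod_univ_eq_prod_range fun s => descentWeight (extendTuple f s)]
            simp only [extendTuple_fin]
        _ = (1 / 25 : ℝ) ^ ((Finset.range (K a)).filter
              fun s => (extendTuple f s).length = 2).card *
              (25 / 36) ^ posOffset (extendTuple f) (K a) := by
            simp only [descentWeight]
            rw [Finset.prod_mul_distrib, Finset.prod_pow_eq_pow_sum, Finset.prod_ite]
            simp [posOffset]
        _ ≤ _ := by
            refine mul_le_mul_of_nonneg_right ?_ (by positivity)
            exact pow_le_pow_of_le_one (by norm_num) (by norm_num) hd
    · refine Finset.sum_le_sum fun m _ => ?_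
      have := sum_arcDescents_le (z := 1 / 5) (by norm_num) (by norm_num) m
      rw [← Finset.sum_mul]
      calc _ ≤ (m * ((1 + 1 / 5 : ℝ) ^ m / (1 / 5)) ^ 2) * (25 / 36) ^ m := by
            refine mul_le_mul_of_nonneg_right ?_ (by positivity)
            norm_num at this ⊢
            exact this
        _ = 25 * m * (((1 + 1 / 5 : ℝ) ^ 2) * (25 / 36)) ^ m := by
            rw [mul_pow, ← pow_mul, mul_comm 2 m, pow_mul]
            ring
        _ = 25 * m := by norm_num

/-! ### Comparison of site weights -/

/-- The local inequalities allowing to bound powers of `x * (1 + x ^ 2)` by the two kinds of site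
weights. -/
def LocalBound (x : ℝ) (r : ℕ) : Prop :=
  (x * ((1 + x ^ 2) * (1 + 2 * x ^ 2 * (1 + x ^ 2) ^ 2))) ^ (r + 1) ≤
      (x * (1 + 2 * x ^ 2 + 8 * x ^ 4 + 42 * x ^ 6)) ^ r * (25 / 36) ∧
    (x ^ 2 * (1 + x ^ 2) ^ 2) ^ (r + 1) ≤
      (x ^ 2 * (1 + 3 * x ^ 2 + 14 * x ^ 4 + 81 * x ^ 6)) ^ r * (25 / 1296)

theorem localBound_of_le {x lo hi c d w : ℝ} {r : ℕ} (hx : 0 < x) (hlo : lo ≤ x ^ 2)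
    (hhi : x ^ 2 ≤ hi) (hw0 : 0 ≤ w) (hw : hi ≤ w ^ 2)
    (h1 : ∀ u : ℝ, lo ≤ u → u ≤ hi → (1 + u) * (1 + 2 * u * (1 + u) ^ 2) ≤
      c * (1 + 2 * u + 8 * u ^ 2 + 42 * u ^ 3))
    (h2 : ∀ u : ℝ, lo ≤ u → u ≤ hi → (1 + u) ^ 2 ≤
      d * (1 + 3 * u + 14 * u ^ 2 + 81 * u ^ 3))
    (h3 : w * ((1 + hi) * (1 + 2 * hi * (1 + hi) ^ 2)) * c ^ r ≤ 25 / 36)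
    (h4 : hi * (1 + hi) ^ 2 * d ^ r ≤ 25 / 1296) : LocalBound x r := by
  have hxw : x ≤ w := by
    exact le_of_sq_le_sq (by linarith) hw0
  obtain ⟨u, hu⟩ : ∃ u, u = x ^ 2 := ⟨_, rfl⟩
  have e4 : x ^ 4 = u ^ 2 := by rw [hu]; ring
  have e6 : x ^ 6 = u ^ 3 := by rw [hu]; ring
  have hu0 : 0 < u := by rw [hu]; positivity
  rw [LocalBound, e4, e6, ← hu]
  rw [← hu] at hlo hhi
  have hhi0 : 0 < hi := hu0.trans_le hhi
  constructor
  · calc _ = x ^ r * (x * ((1 + u) * (1 + 2 * u * (1 + u) ^ 2)) *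
          ((1 + u) * (1 + 2 * u * (1 + u) ^ 2)) ^ r) := by
          rw [mul_pow, pow_succ, pow_succ]
          ring
      _ ≤ x ^ r * (w * ((1 + hi) * (1 + 2 * hi * (1 + hi) ^ 2)) *
          (c * (1 + 2 * u + 8 * u ^ 2 + 42 * u ^ 3)) ^ r) := by
          have := h1 u hlo hhi
          gcongr
      _ = (x * (1 + 2 * u + 8 * u ^ 2 + 42 * u ^ 3)) ^ r *
          (w * ((1 + hi) * (1 + 2 * hi * (1 + hi) ^ 2)) * c ^ r) := by
          rw [mul_pow, mul_pow]
          ring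
      _ ≤ _ := by gcongr
  · calc _ = u ^ r * (u * (1 + u) ^ 2 * ((1 + u) ^ 2) ^ r) := by
          rw [mul_pow, pow_succ, pow_succ]
          ring
      _ ≤ u ^ r * (hi * (1 + hi) ^ 2 * (d * (1 + 3 * u + 14 * u ^ 2 + 81 * u ^ 3)) ^ r) := by
          have := h2 u hlo hhi
          gcongr
      _ = (u * (1 + 3 * u + 14 * u ^ 2 + 81 * u ^ 3)) ^ r * (hi * (1 + hi) ^ 2 * d ^ r) := by
          rw [mul_pow, mul_pow]
          ring
      _ ≤ _ := by gcongr

theorem exists_localBound {x : ℝ} (hx : 0 < x) (h1 : 3 / 50 ≤ x ^ 2) (h2 : x ^ 2 ≤ 287 / 2000) :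
    ∃ r, LocalBound x r := by
  rcases le_total (x ^ 2) (159 / 2000) with h | h
  · refine ⟨15, localBound_of_le (c := 1043 / 1000) (d := 1801 / 2000) (w := 282 / 1000) hx h1 h
      (by norm_num) (by norm_num) (fun u hu hu' => ?_)
      (fun u hu hu' => ?_) (by norm_num) (by norm_num)⟩
    · nlinarith [mul_nonneg (sub_nonneg.2 hu) (sub_nonneg.2 hu'),
        mul_nonneg (sub_nonneg.2 hu) (mul_nonneg (sub_nonneg.2 hu) (sub_nonneg.2 hu))]
    · nlinarith [mul_nonneg (sub_nonneg.2 hu) (sub_nonneg.2 hu'),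
        mul_nonneg (sub_nonneg.2 hu) (mul_nonneg (sub_nonneg.2 hu) (sub_nonneg.2 hu))]
  rcases le_total (x ^ 2) (1 / 10) with h' | h'
  · refine ⟨12, localBound_of_le (c := 26 / 25) (d := 341 / 400) (w := 317 / 1000) hx h h'
      (by norm_num) (by norm_num) (fun u hu hu' => ?_)
      (fun u hu hu' => ?_) (by norm_num) (by norm_num)⟩
    · nlinarith [mul_nonneg (sub_nonneg.2 hu) (sub_nonneg.2 hu'),
        mul_nonneg (sub_nonneg.2 hu) (mul_nonneg (sub_nonneg.2 hu) (sub_nonneg.2 hu))]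
    · nlinarith [mul_nonneg (sub_nonneg.2 hu) (sub_nonneg.2 hu'),
        mul_nonneg (sub_nonneg.2 hu) (mul_nonneg (sub_nonneg.2 hu) (sub_nonneg.2 hu))]
  clear h
  rcases le_total (x ^ 2) (239 / 2000) with h | h
  · refine ⟨9, localBound_of_le (c := 2067 / 2000) (d := 199 / 250) (w := 346 / 1000) hx h' h
      (by norm_num) (by norm_num) (fun u hu hu' => ?_)
      (fun u hu hu' => ?_) (by norm_num) (by norm_num)⟩
    · nlinarith [mul_nonneg (sub_nonneg.2 hu) (sub_nonneg.2 hu'),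
        mul_nonneg (sub_nonneg.2 hu) (mul_nonneg (sub_nonneg.2 hu) (sub_nonneg.2 hu))]
    · nlinarith [mul_nonneg (sub_nonneg.2 hu) (sub_nonneg.2 hu'),
        mul_nonneg (sub_nonneg.2 hu) (mul_nonneg (sub_nonneg.2 hu) (sub_nonneg.2 hu))]
  clear h'
  rcases le_total (x ^ 2) (281 / 2000) with h' | h'
  · refine ⟨8, localBound_of_le (c := 2043 / 2000) (d := 739 / 1000) (w := 375 / 1000) hx h h'
      (by norm_num) (by norm_num) (fun u hu hu' => ?_)
      (fun u hu hu' => ?_) (by norm_num) (by norm_num)⟩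
    · nlinarith [mul_nonneg (sub_nonneg.2 hu) (sub_nonneg.2 hu'),
        mul_nonneg (sub_nonneg.2 hu) (mul_nonneg (sub_nonneg.2 hu) (sub_nonneg.2 hu))]
    · nlinarith [mul_nonneg (sub_nonneg.2 hu) (sub_nonneg.2 hu'),
        mul_nonneg (sub_nonneg.2 hu) (mul_nonneg (sub_nonneg.2 hu) (sub_nonneg.2 hu))]
  clear h
  refine ⟨8, localBound_of_le (c := 2003 / 2000) (d := 677 / 1000) (w := 379 / 1000) hx h' h2
      (by norm_num) (by norm_num) (fun u hu hu' => ?_)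
      (fun u hu hu' => ?_) (by norm_num) (by norm_num)⟩
  · nlinarith [mul_nonneg (sub_nonneg.2 hu) (sub_nonneg.2 hu'),
        mul_nonneg (sub_nonneg.2 hu) (mul_nonneg (sub_nonneg.2 hu) (sub_nonneg.2 hu))]
  · nlinarith [mul_nonneg (sub_nonneg.2 hu) (sub_nonneg.2 hu'),
        mul_nonneg (sub_nonneg.2 hu) (mul_nonneg (sub_nonneg.2 hu) (sub_nonneg.2 hu))]

theorem siteWeight_cases {x y : ℝ} (hx : 0 < x) (hx1 : x ≤ 1) (hxl : 3 / 50 ≤ x ^ 2)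
    (hy : y = x * (1 + x ^ 2)) :
    (∀ k ∈ siteKinds, y ^ k.length ≤ patternWeight x (y ^ 2) k) ∨
      ∃ r, ∀ k ∈ siteKinds, (y ^ k.length) ^ (r + 1) ≤
        patternWeight x (y ^ 2) k ^ r * shortestWeight (y ^ 2) k := by
  obtain ⟨p1, p2, p3, p4, p5⟩ := patternWeight_eq x (y ^ 2)
  obtain ⟨q1, q2, q3, q4, q5⟩ := shortestWeight_eq (y ^ 2)
  have hy0 : 0 < y := by rw [hy]; positivity
  have hD : 0 < 1 + 2 * y ^ 2 := by positivity
  rcases le_total (x ^ 2) (287 / 2000) with h | h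
  · right
    obtain ⟨r, h1, h2⟩ := exists_localBound hx hxl h
    refine ⟨r, ?_⟩
    have h1' : (y * (1 + 2 * y ^ 2)) ^ (r + 1) ≤
        (x + 2 * x ^ 3 + 8 * x ^ 5 + 42 * x ^ 7) ^ r * (25 / 36) := by
      convert h1 using 2
      · rw [hy]; ring
      · ring
    have e1 : y ^ (r + 1) ≤ ((x + 2 * x ^ 3 + 8 * x ^ 5 + 42 * x ^ 7) / (1 + 2 * y ^ 2)) ^ r *
        (25 / 36 / (1 + 2 * y ^ 2)) := by
      rw [div_pow, div_mul_div_comm, ← pow_succ, le_div_iff₀ (by positivity), ← mul_pow]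
      exact h1'
    have e3 : (y ^ 3) ^ (r + 1) ≤
        (y ^ 2 * (x + 2 * x ^ 3 + 8 * x ^ 5 + 42 * x ^ 7) / (1 + 2 * y ^ 2)) ^ r *
        (y ^ 2 * (25 / 36) / (1 + 2 * y ^ 2)) := by
      calc (y ^ 3) ^ (r + 1) = (y ^ 2) ^ (r + 1) * y ^ (r + 1) := by rw [← mul_pow]; ring
        _ ≤ (y ^ 2) ^ (r + 1) * (((x + 2 * x ^ 3 + 8 * x ^ 5 + 42 * x ^ 7) /
              (1 + 2 * y ^ 2)) ^ r * (25 / 36 / (1 + 2 * y ^ 2))) := by gcongr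
        _ = _ := by
          rw [mul_div_assoc, mul_pow, pow_succ (y ^ 2)]
          ring
    have e2 : (y ^ 2) ^ (r + 1) ≤
        (x ^ 2 + 3 * x ^ 4 + 14 * x ^ 6 + 81 * x ^ 8) ^ r * (25 / 1296) := by
      convert h2 using 2
      · rw [hy]; ring
      · ring
    intro k hk
    simp only [siteKinds, Finset.mem_insert, Finset.mem_singleton] at hk
    rcases hk with rfl | rfl | rfl | rfl | rfl
    · rw [p1, q1]; simpa using e1
    · rw [p2, q2]; simpa using e3
    · rw [p3, q3]; simpa using e3
    · rw [p4, q4]; simpa using e2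
    · rw [p5, q5]; simpa using e2
  · left
    obtain ⟨u, hu⟩ : ∃ u, u = x ^ 2 := ⟨_, rfl⟩
    rw [← hu] at h hy
    have hu1 : u ≤ 1 := by rw [hu]; nlinarith
    have e1 : y ≤ (x + 2 * x ^ 3 + 8 * x ^ 5 + 42 * x ^ 7) / (1 + 2 * y ^ 2) := by
      rw [le_div_iff₀ hD]
      have : (1 + u) * (1 + 2 * u * (1 + u) ^ 2) ≤ 1 + 2 * u + 8 * u ^ 2 + 42 * u ^ 3 := by
        nlinarith [mul_nonneg (sub_nonneg.2 h) (sub_nonneg.2 hu1),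
          mul_nonneg (sub_nonneg.2 h) (sub_nonneg.2 h), mul_nonneg (sub_nonneg.2 h)
          (mul_nonneg (sub_nonneg.2 h) (sub_nonneg.2 hu1)), mul_nonneg (mul_nonneg
          (sub_nonneg.2 h) (sub_nonneg.2 h)) (mul_nonneg (sub_nonneg.2 h) (sub_nonneg.2 hu1))]
      calc y * (1 + 2 * y ^ 2) = x * ((1 + u) * (1 + 2 * u * (1 + u) ^ 2)) := by
            rw [hy, hu]; ring
        _ ≤ x * (1 + 2 * u + 8 * u ^ 2 + 42 * u ^ 3) := by gcongr
        _ = _ := by rw [hu]; ring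
    have e3 : y ^ 3 ≤
        y ^ 2 * (x + 2 * x ^ 3 + 8 * x ^ 5 + 42 * x ^ 7) / (1 + 2 * y ^ 2) := by
      calc y ^ 3 = y ^ 2 * y := by ring
        _ ≤ y ^ 2 * ((x + 2 * x ^ 3 + 8 * x ^ 5 + 42 * x ^ 7) / (1 + 2 * y ^ 2)) := by gcongr
        _ = _ := by ring
    have e2 : y ^ 2 ≤ x ^ 2 + 3 * x ^ 4 + 14 * x ^ 6 + 81 * x ^ 8 := by
      calc y ^ 2 = u * (1 + u) ^ 2 := by rw [hy, hu]; ring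
        _ ≤ u * (1 + 3 * u + 14 * u ^ 2 + 81 * u ^ 3) := by
          have : 0 ≤ u := by linarith
          gcongr
          nlinarith [pow_nonneg this 3, pow_nonneg this 2]
        _ = _ := by rw [hu]; ring
    intro k hk
    simp only [siteKinds, Finset.mem_insert, Finset.mem_singleton] at hk
    rcases hk with rfl | rfl | rfl | rfl | rfl
    · rw [p1]; simpa using e1
    · rw [p2]; simpa using e3
    · rw [p3]; simpa using e3
    · rw [p4]; simpa using e2
    · rw [p5]; simpa using e2

theorem kindWeight_nonneg {t : ℝ} (ht : 0 ≤ t) (k : List ℕ) : 0 ≤ kindWeight t k :=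
  (isKindWeight_kindWeight ht).nonneg k

theorem patternWeight_nonneg {x t : ℝ} (hx : 0 ≤ x) (ht : 0 ≤ t) (k : List ℕ) :
    0 ≤ patternWeight x t k :=
  mul_nonneg (kindWeight_nonneg ht k) (Finset.sum_nonneg fun _ _ => by positivity)

theorem shortestWeight_nonneg {t : ℝ} (ht : 0 ≤ t) (k : List ℕ) : 0 ≤ shortestWeight t k := by
  refine mul_nonneg (kindWeight_nonneg ht k) (Finset.sum_nonneg fun l _ => ?_)
  unfold descentWeight
  positivity

theorem le_add_of_pow_le {Y A B : ℝ} {r : ℕ} (hY : 0 < Y) (hA : 0 ≤ A) (hB : 0 ≤ B)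
    (h : Y ^ (r + 1) ≤ A ^ r * B) : Y ≤ A + B := by
  by_contra! hcon
  have h1 : A ^ r ≤ Y ^ r := pow_le_pow_left₀ hA (by linarith) r
  have h2 : A ^ r * B ≤ Y ^ r * B := mul_le_mul_of_nonneg_right h1 hB
  have h3 : Y ^ r * B < Y ^ r * Y := mul_lt_mul_of_pos_left (by linarith) (by positivity)
  rw [pow_succ] at h
  linarith

theorem pow_posOffset_le {x y : ℝ} (hx : 0 < x) (hx1 : x ≤ 1) (hxl : 3 / 50 ≤ x ^ 2)
    (hy : y = x * (1 + x ^ 2)) {K : ℕ} {κ : ℕ → List ℕ} (hκ : ∀ s < K, κ s ∈ siteKinds) :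
    y ^ posOffset κ K ≤ ∏ s ∈ Finset.range K, patternWeight x (y ^ 2) (κ s) +
      ∏ s ∈ Finset.range K, shortestWeight (y ^ 2) (κ s) := by
  have hy0 : 0 < y := by rw [hy]; positivity
  have hA : 0 ≤ ∏ s ∈ Finset.range K, patternWeight x (y ^ 2) (κ s) :=
    Finset.prod_nonneg fun s _ => patternWeight_nonneg hx.le (by positivity) _
  have hB : 0 ≤ ∏ s ∈ Finset.range K, shortestWeight (y ^ 2) (κ s) :=
    Finset.prod_nonneg fun s _ => shortestWeight_nonneg (by positivity) _
  have hκ' : ∀ s ∈ Finset.range K, κ s ∈ siteKinds := fun s hs => hκ s (Finset.mem_range.1 hs)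
  rcases siteWeight_cases hx hx1 hxl hy with h | ⟨r, h⟩
  · refine le_add_of_le_of_nonneg ?_ hB
    rw [posOffset, ← Finset.prod_pow_eq_pow_sum]
    exact Finset.prod_le_prod (fun s _ => by positivity) fun s hs => h _ (hκ' s hs)
  · refine le_add_of_pow_le (r := r) (by positivity) hA hB ?_
    rw [posOffset, ← Finset.prod_pow_eq_pow_sum, ← Finset.prod_pow, ← Finset.prod_pow,
      ← Finset.prod_mul_distrib]
    exact Finset.prod_le_prod (fun s _ => by positivity) fun s hs => h _ (hκ' s hs)

theorem irrMeanderCount_mul_pow_le {x y : ℝ} (hx : 0 < x) (hx1 : x ≤ 1) (hxl : 3 / 50 ≤ x ^ 2)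
    (hy : y = x * (1 + x ^ 2)) {N : ℕ} (hN : 7 ≤ N) :
    (irrMeanderCount N : ℝ) * y ^ N ≤
      ∑ m ∈ Finset.range (8 * N + 1), (openMeanderCount m : ℝ) * x ^ m +
        ∑ m ∈ Finset.range (8 * N + 1), 25 * (m : ℝ) := by
  obtain ⟨K, κ, hκ, h1, h2⟩ := exists_site_weights hN
  have hy2 : 0 ≤ y ^ 2 := by positivity
  refine le_trans ?_ (add_le_add (h1 x (y ^ 2) hx.le hy2) (h2 (y ^ 2) hy2))
  rw [← Finset.sum_add_distrib, irrMeanderCount_eq, ← nsmul_eq_mul, ← Finset.sum_const]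
  refine Finset.sum_le_sum fun a ha => ?_
  obtain ⟨hk, hn⟩ := hκ a ha
  have := pow_posOffset_le hx hx1 hxl hy hk
  rwa [hn] at this

/-! ### Growth rates -/

theorem tendsto_natCast_rpow_div (c : ℝ) :
    Tendsto (fun n : ℕ => (n : ℝ) ^ (c / (n : ℝ))) atTop (nhds 1) := by
  have h := (tendsto_rpow_div_mul_add c 1 0 zero_ne_one).comp tendsto_natCast_atTop_atTop
  refine h.congr fun n => ?_
  simp

section Growth

variable {L : ℝ}
  (hL : Tendsto (fun n : ℕ => (openMeanderCount n : ℝ) ^ (1 / (n : ℝ))) atTop (nhds L))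
include hL

theorem one_le_growth : 1 ≤ L := by
  refine ge_of_tendsto hL ?_
  filter_upwards [eventually_ge_atTop 1] with n hn
  refine Real.one_le_rpow ?_ (by positivity)
  rw [openMeanderCount_eq]
  exact_mod_cast card_meanders_pos hn

theorem growth_le_four : L ≤ 4 := by
  have h : Tendsto (fun n : ℕ => (n : ℝ) ^ (1 / (n : ℝ)) * 4) atTop (nhds (1 * 4)) :=
    (tendsto_natCast_rpow_div 1).mul_const 4
  rw [one_mul] at h
  refine le_of_tendsto_of_tendsto hL h ?_
  filter_upwards [eventually_ge_atTop 1] with n hn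
  have hn' : (n : ℝ) ≠ 0 := by positivity
  calc (openMeanderCount n : ℝ) ^ (1 / (n : ℝ)) ≤ (n * 4 ^ n : ℝ) ^ (1 / (n : ℝ)) := by
        refine Real.rpow_le_rpow (by positivity) ?_ (by positivity)
        rw [openMeanderCount_eq]
        exact card_meanders_le n
    _ = (n : ℝ) ^ (1 / (n : ℝ)) * 4 := by
        rw [Real.mul_rpow (by positivity) (by positivity), ← Real.rpow_natCast 4 n,
          ← Real.rpow_mul (by norm_num), mul_one_div_cancel hn', Real.rpow_one]

theorem exists_bound_openMeanderCount {x : ℝ} (hx : 0 < x) (hxL : L < x⁻¹) :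
    ∃ C : ℝ, 0 ≤ C ∧ ∀ m : ℕ, (openMeanderCount m : ℝ) * x ^ m ≤ C := by
  have hev : ∀ᶠ m : ℕ in atTop, (openMeanderCount m : ℝ) * x ^ m ≤ 1 := by
    filter_upwards [hL.eventually_lt_const hxL, eventually_ge_atTop 1] with m hm hm1
    have h := pow_le_pow_left₀ (by positivity) hm.le m
    rw [one_div, Real.rpow_inv_natCast_pow (by positivity) (by omega), inv_pow] at h
    calc _ ≤ (x ^ m)⁻¹ * x ^ m := mul_le_mul_of_nonneg_right h (by positivity)
      _ = 1 := inv_mul_cancel₀ (by positivity)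
  obtain ⟨C, hC⟩ := IsBoundedUnder.bddAbove_range
    (f := fun m : ℕ => (openMeanderCount m : ℝ) * x ^ m) ⟨1, eventually_map.2 hev⟩
  exact ⟨max C 0, le_max_right _ _, fun m => (hC ⟨m, rfl⟩).trans (le_max_left _ _)⟩

theorem limsup_irrMeanderCount_le {x : ℝ} (hx : 0 < x) (hxl : 3 / 50 ≤ x ^ 2) (hxL : L < x⁻¹) :
    limsup (fun n : ℕ => (irrMeanderCount n : ℝ) ^ (1 / (n : ℝ))) atTop ≤
      (x * (1 + x ^ 2))⁻¹ := by
  obtain ⟨C, hC0, hC⟩ := exists_bound_openMeanderCount hL hx hxL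
  have hx1 : x ≤ 1 := by
    have := (one_le_growth hL).trans hxL.le
    exact (one_le_inv₀ hx).1 this
  obtain ⟨y, hy⟩ : ∃ y, y = x * (1 + x ^ 2) := ⟨_, rfl⟩
  have hy0 : 0 < y := by rw [hy]; positivity
  rw [← hy]
  have hlim : Tendsto (fun n : ℕ => (n : ℝ) ^ (3 / (n : ℝ)) * y⁻¹) atTop (nhds y⁻¹) := by
    simpa using (tendsto_natCast_rpow_div 3).mul_const y⁻¹
  have hle : ∀ᶠ n : ℕ in atTop,
      (irrMeanderCount n : ℝ) ^ (1 / (n : ℝ)) ≤ (n : ℝ) ^ (3 / (n : ℝ)) * y⁻¹ := by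
    filter_upwards [eventually_ge_atTop 7, eventually_ge_atTop ⌈9 * C + 1800⌉₊] with n hn hnC
    have hn' : (n : ℝ) ≠ 0 := by positivity
    have hn1 : (1 : ℝ) ≤ n := by exact_mod_cast (by omega : 1 ≤ n)
    have hnC : 9 * C + 1800 ≤ (n : ℝ) := (Nat.le_ceil _).trans (by exact_mod_cast hnC)
    have h1 := irrMeanderCount_mul_pow_le hx hx1 hxl hy hn
    have h2 : ∑ m ∈ Finset.range (8 * n + 1), (openMeanderCount m : ℝ) * x ^ m ≤
        (8 * n + 1) * C := by
      refine (Finset.sum_le_sum fun m _ => hC m).trans (le_of_eq ?_)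
      simp
    have h3 : ∑ m ∈ Finset.range (8 * n + 1), 25 * (m : ℝ) ≤ (8 * n + 1) * (25 * (8 * n)) := by
      refine (Finset.sum_le_sum fun m hm => ?_).trans
        (le_of_eq (b := ∑ _m ∈ Finset.range (8 * n + 1), (25 * (8 * n) : ℝ)) rfl |>.trans
          (le_of_eq ?_))
      · have : m ≤ 8 * n := by
          have := Finset.mem_range.1 hm
          omega
        have : (m : ℝ) ≤ 8 * n := by exact_mod_cast this
        linarith
      · simp
    have h4 : (irrMeanderCount n : ℝ) * y ^ n ≤ (n : ℝ) ^ 3 := by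
      have h5 : (8 * n + 1) * C ≤ 9 * n * C := by gcongr; linarith
      have h6 : (8 * n + 1 : ℝ) * (25 * (8 * n)) ≤ 1800 * n * n := by nlinarith
      have h7 : 9 * n * C ≤ 9 * n * n * C := by
        have : 0 ≤ 9 * (n : ℝ) * C := by positivity
        nlinarith
      have h8 : (9 * C + 1800) * (n * n : ℝ) ≤ n * (n * n) := by gcongr
      nlinarith
    have h5 : (irrMeanderCount n : ℝ) ≤ (n : ℝ) ^ 3 * y⁻¹ ^ n := by
      rw [inv_pow, ← div_eq_mul_inv, le_div_iff₀ (by positivity)]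
      exact h4
    calc (irrMeanderCount n : ℝ) ^ (1 / (n : ℝ)) ≤
          ((n : ℝ) ^ 3 * y⁻¹ ^ n) ^ (1 / (n : ℝ)) :=
          Real.rpow_le_rpow (by positivity) h5 (by positivity)
      _ = _ := by
        rw [Real.mul_rpow (by positivity) (by positivity), ← Real.rpow_natCast y⁻¹ n,
          ← Real.rpow_mul (by positivity), mul_one_div_cancel hn', Real.rpow_one,
          ← Real.rpow_natCast (n : ℝ) 3, ← Real.rpow_mul (by positivity), mul_one_div]
        norm_num
  refine (limsup_le_limsup hle ?_ hlim.isBoundedUnder_le).trans hlim.limsup_eq.le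
  exact (isBoundedUnder_of ⟨0, fun n => by positivity⟩ :
    IsBoundedUnder (· ≥ ·) atTop _).isCoboundedUnder_le

theorem limsup_irrMeanderCount_le_growth :
    limsup (fun n : ℕ => (irrMeanderCount n : ℝ) ^ (1 / (n : ℝ))) atTop ≤
      (L⁻¹ * (1 + L⁻¹ ^ 2))⁻¹ := by
  have h1 := one_le_growth hL
  have h4 := growth_le_four hL
  have hL0 : 0 < L := by linarith
  have hinv : 0 < L⁻¹ := by positivity
  have hlow : (49 / 200 : ℝ) < L⁻¹ := by
    rw [lt_inv_comm₀ (by norm_num) hL0]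
    norm_num
    linarith
  have hcont : Tendsto (fun x : ℝ => (x * (1 + x ^ 2))⁻¹) (nhdsWithin L⁻¹ (Set.Iio L⁻¹))
      (nhds (L⁻¹ * (1 + L⁻¹ ^ 2))⁻¹) := by
    refine Tendsto.inv₀ (Tendsto.mono_left ?_ nhdsWithin_le_nhds) (by positivity)
    exact Continuous.tendsto (by fun_prop) _
  refine ge_of_tendsto hcont ?_
  filter_upwards [Ioo_mem_nhdsLT hlow] with x hx
  have hx0 : 0 < x := by linarith [hx.1]
  refine limsup_irrMeanderCount_le hL hx0 (by nlinarith [hx.1]) ?_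
  rw [lt_inv_comm₀ hL0 hx0]
  exact hx.2

end Growth

theorem growth_bound_le {L : ℝ} (hL : 0 < L) {k : ℝ} (hk : 1 < k) :
    (L⁻¹ * (1 + L⁻¹ ^ 2))⁻¹ ≤ (k - 1) ^ ((k - 1) / k) / k * L ^ ((k + 2) / k) := by
  have hk0 : 0 < k := by linarith
  have hk1 : 0 < k - 1 := by linarith
  have hw : 1 / k + (k - 1) / k = 1 := by field_simp; ring
  have h := Real.geom_mean_le_arith_mean2_weighted (w₁ := 1 / k) (w₂ := (k - 1) / k)
    (p₁ := k * L⁻¹ ^ 2) (p₂ := k / (k - 1)) (by positivity) (by positivity) (by positivity)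
    (by positivity) hw
  have hA : 0 < (k - 1) ^ ((k - 1) / k) := by positivity
  have hB : 0 < L ^ (2 / k) := by positivity
  have e1 : L⁻¹ ^ 2 = L ^ (-2 : ℝ) := by
    rw [Real.rpow_neg hL.le, inv_pow]
    norm_num
  have e2 : (k * L⁻¹ ^ 2) ^ (1 / k) * (k / (k - 1)) ^ ((k - 1) / k) =
      k / ((k - 1) ^ ((k - 1) / k) * L ^ (2 / k)) := by
    rw [Real.mul_rpow hk0.le (by positivity), Real.div_rpow hk0.le hk1.le, e1,
      ← Real.rpow_mul hL.le, show (-2 : ℝ) * (1 / k) = -(2 / k) by ring, Real.rpow_neg hL.le]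
    have : k ^ (1 / k) * k ^ ((k - 1) / k) = k := by
      rw [← Real.rpow_add hk0, hw, Real.rpow_one]
    calc _ = k ^ (1 / k) * k ^ ((k - 1) / k) / ((k - 1) ^ ((k - 1) / k) * L ^ (2 / k)) := by ring
      _ = _ := by rw [this]
  have e3 : 1 / k * (k * L⁻¹ ^ 2) + (k - 1) / k * (k / (k - 1)) = 1 + L⁻¹ ^ 2 := by
    field_simp
    ring
  have e4 : L ^ ((k + 2) / k) = L * L ^ (2 / k) := by
    rw [add_div, div_self hk0.ne', Real.rpow_add hL, Real.rpow_one]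
  rw [e2, e3] at h
  rw [e4, mul_inv, inv_inv]
  calc L * (1 + L⁻¹ ^ 2)⁻¹ ≤ L * (k / ((k - 1) ^ ((k - 1) / k) * L ^ (2 / k)))⁻¹ := by gcongr
    _ = _ := by
      rw [inv_div]
      ring

/-- If `L = lim (M n)^(1/n)` exists, then for every integer `k ≥ 2`,
`limsup (M^{Irr} n)^(1/n) ≤ (k-1)^((k-1)/k) / k * L^((k+2)/k)`. -/
theorem irr_meander_growth_upper_bound_param (L : ℝ)
    (hL : Tendsto (fun n : ℕ => (openMeanderCount n : ℝ) ^ (1 / (n : ℝ))) atTop (nhds L)) :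
    ∀ k : ℕ, 2 ≤ k →
      limsup (fun n : ℕ => (irrMeanderCount n : ℝ) ^ (1 / (n : ℝ))) atTop ≤
        ((k : ℝ) - 1) ^ (((k : ℝ) - 1) / (k : ℝ)) / (k : ℝ) *
          L ^ (((k : ℝ) + 2) / (k : ℝ)) := by
  intro k hk
  have hL0 : 0 < L := zero_lt_one.trans_le (one_le_growth hL)
  exact (limsup_irrMeanderCount_le_growth hL).trans
    (growth_bound_le hL0 (by exact_mod_cast (by omega : 1 < k)))
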